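/- arXiv:2104.13811 — 2 statements merged into one kernel-verified Lean document; each statement's English description precedes it below -/
import Mathlib

section
/- Let K be a field, R = K[x_1,…,x_d] a polynomial ring in d > 0 indeterminates, t, m, n integers with 1 ≤ t < m ≤ n, and A an m×n matrix over R such that I = I_t(A) is of generic height, i.e. ht I = (m−t+1)(n−t+1). Let X be a generic m×n matrix over R, B = R[X], J = I_t(X), and let N be the B-ideal generated by the entries of X − A; regard R as a B-algebra via the isomorphism B/N ≅ R (sending X_{ij} to A_{ij}). If ht I_j(A) ≥ (m−j+1)(n−j+1) for all 1 ≤ j ≤ t−1, then for every positive integer k the natural surjection J^k ⊗_B R → I^k is an isomorphism of R-modules; equivalently, the natural map R[Ju] ⊗_B R → R[Iu] between Rees algebras is an isomorphism. -/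
open Matrix

/-- The ideal generated by the `t × t` minors of a matrix. -/
noncomputable def minorsIdeal {R : Type*} [CommRing R] {α β : Type*}
    (t : ℕ) (A : Matrix α β R) : Ideal R :=
  Ideal.span {d : R | ∃ (f : Fin t → α) (g : Fin t → β),
    Function.Injective f ∧ Function.Injective g ∧ d = (A.submatrix f g).det}

/-- The height of an ideal: the infimum of the heights of primes containing it. -/
noncomputable def idealHeight {R : Type*} [CommRing R] (I : Ideal R) : ℕ∞ :=
  ⨅ p ∈ {p : PrimeSpectrum R | I ≤ p.asIdeal}, Order.height p

/-- The minimal number of generators of an ideal. -/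
noncomputable def mu {R : Type*} [CommRing R] (I : Ideal R) : ℕ :=
  sInf {n : ℕ | ∃ s : Finset R, s.card = n ∧ Ideal.span (s : Set R) = I}

/-- The condition `G_s`. -/
def SatisfiesG {R : Type*} [CommRing R] (I : Ideal R) (s : ℕ) : Prop :=
  ∀ (p : Ideal R) (hp : p.IsPrime), I ≤ p →
    haveI := hp
    ringKrullDim (Localization.AtPrime p) ≤ ((s - 1 : ℕ) : WithBot ℕ∞) →
    (mu (I.map (algebraMap R (Localization.AtPrime p))) : WithBot ℕ∞) ≤
      ringKrullDim (Localization.AtPrime p)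

section

open RingTheory.Sequence CategoryTheory Abelian Pointwise

universe u

/-- Over a Noetherian local ring, cutting by a nonzerodivisor lowers the length of available
regular sequences by at most one. -/
theorem exists_isWeaklyRegular_quotSMulTop
    {A : Type u} [CommRing A] [IsLocalRing A] [IsNoetherianRing A]
    {M : Type u} [AddCommGroup M] [Module A M] [Module.Finite A M] [Nontrivial M]
    {rs : List A} {r : ℕ} (hlen : rs.length = r + 1)
    (hmem : ∀ x ∈ rs, x ∈ IsLocalRing.maximalIdeal A) (hreg : IsWeaklyRegular M rs)
    {x : A} (hx : x ∈ IsLocalRing.maximalIdeal A) (hxreg : IsSMulRegular M x) :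
    ∃ rs' : List A, rs'.length = r ∧ (∀ x ∈ rs', x ∈ IsLocalRing.maximalIdeal A) ∧
      IsWeaklyRegular (QuotSMulTop x M) rs' := by
  have lt_top (M : Type u) [AddCommGroup M] [Module A M] [Module.Finite A M] [Nontrivial M] :
      IsLocalRing.maximalIdeal A • (⊤ : Submodule A M) < ⊤ :=
    (Submodule.top_ne_ideal_smul_of_le_jacobson_annihilator
      (IsLocalRing.maximalIdeal_le_jacobson _)).symm.lt_top
  have : Nontrivial (QuotSMulTop x M) := nontrivial_quotSMulTop_of_mem_maximalIdeal M hx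
  let N := ModuleCat.of A (A ⧸ IsLocalRing.maximalIdeal A)
  have hsupp : Module.support A N = PrimeSpectrum.zeroLocus (IsLocalRing.maximalIdeal A) := by
    rw [Module.support_eq_zeroLocus, Ideal.annihilator_quotient]
  have hext := ModuleCat.subsingleton_ext_of_exists_isRegular (IsLocalRing.maximalIdeal A) N
    hsupp.subset (ModuleCat.of A M) (lt_top M) rs hmem
    (IsRegular.of_isWeaklyRegular_of_mem_maximalIdeal M hmem hreg)
  have hext' : ∀ i < r, Subsingleton (Ext N (ModuleCat.of A (QuotSMulTop x M)) i) := by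
    intro i hi
    have zero1 := AddCommGrpCat.isZero_of_iff_subsingleton.mpr (hext i (by omega))
    have zero2 := AddCommGrpCat.isZero_of_iff_subsingleton.mpr (hext (i + 1) (by omega))
    have hxreg' : IsSMulRegular (ModuleCat.of A M) x := hxreg
    exact AddCommGrpCat.subsingleton_of_isZero <| ShortComplex.Exact.isZero_of_both_zeros
      ((Ext.covariant_sequence_exact₃' N hxreg'.smulShortComplex_shortExact) i (i + 1) rfl)
      (zero1.eq_zero_of_src _) (zero2.eq_zero_of_tgt _)
  obtain ⟨rs', h1, h2, h3⟩ := ModuleCat.exists_isRegular_of_exists_subsingleton_ext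
    (IsLocalRing.maximalIdeal A) r (ModuleCat.of A (QuotSMulTop x M)) (lt_top _) N hsupp hext'
  exact ⟨rs', h1, h2, h3.toIsWeaklyRegular⟩

/-- Prime avoidance for a coset `y + N` of an ideal. -/
theorem exists_mem_forall_add_notMem {B : Type*} [CommRing B] (N : Ideal B) (y : B)
    (S : Finset (Ideal B)) (hS : ∀ P ∈ S, P.IsPrime) (hN : ∀ P ∈ S, y ∈ P → ¬ N ≤ P) :
    ∃ z ∈ N, ∀ P ∈ S, y + z ∉ P := by
  classical
  induction h : S.card generalizing S with
  | zero => exact ⟨0, N.zero_mem, by simp [Finset.card_eq_zero.mp h]⟩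
  | succ s ih =>
    obtain ⟨P, hP⟩ := S.exists_minimal (Finset.card_pos.mp (by omega))
    obtain ⟨z₀, hz₀, hz₀'⟩ := ih (S.erase P) (fun P' h' => hS P' (Finset.mem_of_mem_erase h'))
      (fun P' h' => hN P' (Finset.mem_of_mem_erase h')) (by
        rw [Finset.card_erase_of_mem hP.1, h]; rfl)
    have hPp := hS P hP.1
    by_cases hy : y + z₀ ∈ P
    · have hNP : ¬ N ≤ P := fun hle =>
        hN P hP.1 (by simpa using P.sub_mem hy (hle hz₀)) hle
      obtain ⟨w, hwN, hwP⟩ := SetLike.not_le_iff_exists.mp hNP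
      have : ∀ P' ∈ S.erase P, ∃ u ∈ P', u ∉ P := fun P' h' =>
        SetLike.not_le_iff_exists.mp fun hle =>
          Finset.ne_of_mem_erase h' (le_antisymm hle (hP.2 (Finset.mem_of_mem_erase h') hle))
      choose! u hu hu' using this
      have hv : w * ∏ P' ∈ S.erase P, u P' ∉ P := by
        refine hPp.mul_notMem hwP fun hprod => ?_
        obtain ⟨P', h', h''⟩ := (hPp.prod_mem_iff).mp hprod
        exact hu' P' h' h''
      refine ⟨z₀ + w * ∏ P' ∈ S.erase P, u P', N.add_mem hz₀ (N.mul_mem_right _ hwN), ?_⟩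
      intro P' h' hmem
      rw [← add_assoc] at hmem
      by_cases hPP : P' = P
      · subst hPP
        exact hv ((P'.add_mem_iff_right hy).mp hmem)
      · have h'' : P' ∈ S.erase P := Finset.mem_erase.mpr ⟨hPP, h'⟩
        refine hz₀' P' h'' ((P'.add_mem_iff_left ?_).mp hmem)
        rw [← Finset.mul_prod_erase _ _ h'']
        exact P'.mul_mem_left _ (P'.mul_mem_right _ (hu P' h''))
    · refine ⟨z₀, hz₀, fun P' h' => ?_⟩
      by_cases hPP : P' = P
      · exact hPP ▸ hy
      · exact hz₀' P' (Finset.mem_erase.mpr ⟨hPP, h'⟩)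

end

section

open RingTheory.Sequence Pointwise

universe u

/-- The localization at `Q` of the quotient by `c` admits a weakly regular sequence of length `r`
in the maximal ideal. -/
def LocalDepthGE {B : Type*} [CommRing B] (c Q : Ideal B) [Q.IsPrime] (r : ℕ) : Prop :=
  ∃ rs : List (Localization.AtPrime Q), rs.length = r ∧
    (∀ x ∈ rs, x ∈ IsLocalRing.maximalIdeal (Localization.AtPrime Q)) ∧
    IsWeaklyRegular
      (Localization.AtPrime Q ⧸ c.map (algebraMap B (Localization.AtPrime Q))) rs

theorem isSMulRegular_localization_quotient {B : Type*} [CommRing B] {c Q : Ideal B} [Q.IsPrime]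
    {y : B} (hy : IsSMulRegular (B ⧸ c) y) :
    IsSMulRegular (Localization.AtPrime Q ⧸ c.map (algebraMap B (Localization.AtPrime Q)))
      (algebraMap B (Localization.AtPrime Q) y) := by
  rw [isSMulRegular_quotient_iff_mem_of_smul_mem] at hy ⊢
  intro a ha
  obtain ⟨b, s, rfl⟩ := IsLocalization.exists_mk'_eq Q.primeCompl a
  rw [smul_eq_mul, IsLocalization.mul_mk'_eq_mk'_of_mul,
    IsLocalization.mk'_mem_map_algebraMap_iff] at ha
  obtain ⟨u, hu, h⟩ := ha
  rw [IsLocalization.mk'_mem_map_algebraMap_iff]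
  refine ⟨u, hu, hy _ ?_⟩
  rw [smul_eq_mul]
  convert h using 1
  ring

theorem LocalDepthGE.sup_span_singleton {B : Type u} [CommRing B] [IsNoetherianRing B]
    {c Q : Ideal B} [Q.IsPrime] {r : ℕ} (h : LocalDepthGE c Q (r + 1)) {y : B}
    (hcQ : c ≤ Q) (hyQ : y ∈ Q) (hy : IsSMulRegular (B ⧸ c) y) :
    LocalDepthGE (c ⊔ Ideal.span {y}) Q r := by
  obtain ⟨rs, hlen, hmem, hreg⟩ := h
  let A := Localization.AtPrime Q
  have hc : c.map (algebraMap B A) ≤ IsLocalRing.maximalIdeal A := by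
    rw [← Localization.AtPrime.map_eq_maximalIdeal]
    exact Ideal.map_mono hcQ
  have : Nontrivial (A ⧸ c.map (algebraMap B A)) := Ideal.Quotient.nontrivial_iff.mpr
    (ne_top_of_le_ne_top Ideal.IsPrime.ne_top' hc)
  have hyA : algebraMap B A y ∈ IsLocalRing.maximalIdeal A := by
    rw [← Localization.AtPrime.map_eq_maximalIdeal]
    exact Ideal.mem_map_of_mem _ hyQ
  obtain ⟨rs', h1, h2, h3⟩ := exists_isWeaklyRegular_quotSMulTop hlen hmem hreg hyA
    (isSMulRegular_localization_quotient hy)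
  refine ⟨rs', h1, h2, ?_⟩
  have hle : c.map (algebraMap B A) ≤ (c ⊔ Ideal.span {y}).map (algebraMap B A) :=
    Ideal.map_mono le_sup_left
  have heq : algebraMap B A y • (⊤ : Submodule A (A ⧸ c.map (algebraMap B A))) =
      Submodule.map (Submodule.mkQ (c.map (algebraMap B A)))
        ((c ⊔ Ideal.span {y}).map (algebraMap B A)) := by
    rw [Ideal.map_sup, Ideal.map_span, Set.image_singleton, Submodule.map_sup,
      ← Submodule.range_mkQ, ← Submodule.map_top, ← Submodule.map_pointwise_smul,
      ← Submodule.ideal_span_singleton_smul, smul_eq_mul, Ideal.mul_top]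
    simp
  let e := (Submodule.quotEquivOfEq _ _ heq).trans (Submodule.quotientQuotientEquivQuotient
    (c.map (algebraMap B A)) ((c ⊔ Ideal.span {y}).map (algebraMap B A)) hle)
  exact (e.isWeaklyRegular_congr rs').mp h3

theorem LocalDepthGE.notMem_associatedPrimes {B : Type*} [CommRing B] [IsNoetherianRing B]
    {c Q : Ideal B} [Q.IsPrime] {r : ℕ} (h : LocalDepthGE c Q (r + 1)) :
    Q ∉ associatedPrimes B (B ⧸ c) := by
  rintro hQ
  obtain ⟨rs, hlen, hmem, hreg⟩ := h
  obtain ⟨x, rs, rfl⟩ := List.exists_cons_of_length_eq_add_one hlen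
  rw [isWeaklyRegular_cons_iff] at hreg
  have hxreg := hreg.1
  have hx := hmem x (by simp)
  obtain ⟨v, hv⟩ := (isAssociatedPrime_iff.mp hQ).2
  obtain ⟨b, rfl⟩ := Ideal.Quotient.mk_surjective v
  have hv' : ∀ q : B, q ∈ Q ↔ q * b ∈ c := fun q => by
    rw [hv, Submodule.mem_colon_singleton, Submodule.mem_bot, ← Ideal.Quotient.eq_zero_iff_mem]
    rfl
  obtain ⟨q, s, rfl⟩ := IsLocalization.exists_mk'_eq Q.primeCompl x
  rw [IsLocalization.AtPrime.mk'_mem_maximal_iff _ Q] at hx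
  rw [isSMulRegular_quotient_iff_mem_of_smul_mem] at hxreg
  have hb := hxreg (algebraMap B _ b) (by
    rw [smul_eq_mul, mul_comm, IsLocalization.mul_mk'_eq_mk'_of_mul,
      IsLocalization.mk'_mem_map_algebraMap_iff]
    exact ⟨1, one_mem _, by simpa [mul_comm] using (hv' q).mp hx⟩)
  rw [IsLocalization.algebraMap_mem_map_algebraMap_iff Q.primeCompl] at hb
  obtain ⟨u, hu, hub⟩ := hb
  exact hu ((hv' u).mpr hub)

/-- If `N` is generated by `r` elements and `B ⧸ c` has depth at least `r` at all primes
containing `c + N`, then `Tor₁(B ⧸ c, B ⧸ N) = 0`. -/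
theorem inf_ofList_le_mul {B : Type u} [CommRing B] [IsNoetherianRing B] (ys : List B)
    (c : Ideal B) (h : ∀ (Q : Ideal B) [Q.IsPrime], c ≤ Q → Ideal.ofList ys ≤ Q →
      LocalDepthGE c Q ys.length) :
    c ⊓ Ideal.ofList ys ≤ c * Ideal.ofList ys := by
  induction ys generalizing c with
  | nil => simp
  | cons y₁ ys ih =>
    have hfin := associatedPrimes.finite B (B ⧸ c)
    have hle : ∀ P ∈ associatedPrimes B (B ⧸ c), c ≤ P := fun P hP => by
      simpa [Submodule.annihilator_top, Ideal.annihilator_quotient] using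
        IsAssociatedPrime.annihilator_le hP
    obtain ⟨z, hz, hz'⟩ := exists_mem_forall_add_notMem (Ideal.ofList ys) y₁ hfin.toFinset
      (fun P hP => (hfin.mem_toFinset.mp hP).1) (fun P hP hy hN => by
        rw [hfin.mem_toFinset] at hP
        have := hP.1
        refine (h P (hle P hP) ?_).notMem_associatedPrimes hP
        rw [Ideal.ofList_cons]
        exact sup_le ((Ideal.span_singleton_le_iff_mem _).mpr hy) hN)
    set y := y₁ + z with hy
    have hyreg : IsSMulRegular (B ⧸ c) y := by
      have := biUnion_associatedPrimes_eq_compl_regular B (B ⧸ c)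
      by_contra hcon
      have hmem : y ∈ ⋃ p ∈ associatedPrimes B (B ⧸ c), (p : Set B) := by
        rw [this]; exact hcon
      simp only [Set.mem_iUnion] at hmem
      obtain ⟨P, hP, hyP⟩ := hmem
      exact hz' P (hfin.mem_toFinset.mpr hP) hyP
    have hspan : Ideal.ofList (y₁ :: ys) = Ideal.span {y} ⊔ Ideal.ofList ys := by
      rw [Ideal.ofList_cons]
      apply le_antisymm
      · refine sup_le ((Ideal.span_singleton_le_iff_mem _).mpr ?_) le_sup_right
        have : y₁ = y - z := by rw [hy]; ring
        rw [this]
        exact Ideal.sub_mem _ (Ideal.mem_sup_left (Ideal.mem_span_singleton_self y))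
          (Ideal.mem_sup_right hz)
      · refine sup_le ((Ideal.span_singleton_le_iff_mem _).mpr ?_) le_sup_right
        exact Ideal.add_mem _ (Ideal.mem_sup_left (Ideal.mem_span_singleton_self y₁))
          (Ideal.mem_sup_right hz)
    clear_value y
    have hih := ih (c ⊔ Ideal.span {y}) fun Q _ h₁ h₂ => by
      have hyQ : y ∈ Q := h₁ (Ideal.mem_sup_right (Ideal.mem_span_singleton_self y))
      refine (h Q (le_sup_left.trans h₁) ?_).sup_span_singleton (le_sup_left.trans h₁) hyQ hyreg
      rw [hspan]
      exact sup_le (le_sup_right.trans h₁) h₂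
    rintro a ⟨hac, haN⟩
    rw [SetLike.mem_coe, hspan, Submodule.mem_sup] at haN
    obtain ⟨yb, hyb, n, hn, rfl⟩ := haN
    obtain ⟨b, rfl⟩ := Ideal.mem_span_singleton'.mp hyb
    have hn' := hih (show n ∈ (c ⊔ Ideal.span {y}) ⊓ Ideal.ofList ys from ⟨by
      have : n = (b * y + n) - b * y := by ring
      rw [this]
      exact Ideal.sub_mem _ (Ideal.mem_sup_left hac) (Ideal.mem_sup_right hyb), hn⟩)
    rw [Ideal.sup_mul, Submodule.mem_sup] at hn'
    obtain ⟨u, hu, v, hv, rfl⟩ := hn'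
    obtain ⟨w, hw, rfl⟩ := Ideal.mem_span_singleton_mul.mp hv
    have huc : u ∈ c := (Ideal.mul_le_left : c * Ideal.ofList ys ≤ c) hu
    have hbw : b + w ∈ c := by
      rw [isSMulRegular_quotient_iff_mem_of_smul_mem] at hyreg
      apply hyreg
      have : y • (b + w) = (b * y + (u + y * w)) - u := by rw [smul_eq_mul]; ring
      rw [this]
      exact Ideal.sub_mem _ hac huc
    have : b * y + (u + y * w) = (b + w) * y + u := by ring
    rw [this, hspan]
    exact Ideal.add_mem _
      (Ideal.mul_mem_mul hbw (Ideal.mem_sup_left (Ideal.mem_span_singleton_self y)))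
      (Ideal.mul_mono_right le_sup_right hu)

end

section

open RingTheory.Sequence Pointwise

/-- `rs` is a sequence in the prime `p` which becomes weakly regular after localizing at `p`. -/
structure IsRegularAt {R : Type*} [CommRing R] (p : Ideal R) (rs : List R) : Prop where
  mem : ∀ r ∈ rs, r ∈ p
  reg : ∀ (i : ℕ) (h : i < rs.length) (g : R), rs[i] * g ∈ Ideal.ofList (rs.take i) →
    ∃ u ∉ p, u * g ∈ Ideal.ofList (rs.take i)

/-- There is a sequence of length `n` in `p` that is weakly regular after localizing at `p`. -/
def PrimeDepthGE {R : Type*} [CommRing R] (p : Ideal R) (n : ℕ) : Prop :=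
  ∃ rs : List R, rs.length = n ∧ IsRegularAt p rs

theorem primeDepthGE_zero {R : Type*} [CommRing R] (p : Ideal R) : PrimeDepthGE p 0 :=
  ⟨[], rfl, by simp, by simp⟩

theorem IsRegularAt.isWeaklyRegular {R S : Type*} [CommRing R] [CommRing S] [Algebra R S]
    {p : Ideal R} [p.IsPrime] [IsLocalization.AtPrime S p]
    {rs : List R} (h : IsRegularAt p rs) :
    IsWeaklyRegular S (rs.map (algebraMap R S)) := by
  rw [isWeaklyRegular_iff]
  intro i hi
  rw [isSMulRegular_quotient_iff_mem_of_smul_mem]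
  intro x hx
  rw [List.getElem_map] at hx
  rw [← List.map_take, ← Ideal.map_ofList, smul_eq_mul, Ideal.mul_top] at hx ⊢
  obtain ⟨b, s, rfl⟩ := IsLocalization.exists_mk'_eq p.primeCompl x
  rw [smul_eq_mul, IsLocalization.mul_mk'_eq_mk'_of_mul,
    IsLocalization.mk'_mem_map_algebraMap_iff] at hx
  obtain ⟨u, hu, hub⟩ := hx
  obtain ⟨v, hv, hvb⟩ := h.reg i (by simpa using hi) (u * b) (by convert hub using 1; ring)
  rw [IsLocalization.mk'_mem_map_algebraMap_iff]
  refine ⟨v * u, p.primeCompl.mul_mem hv hu, ?_⟩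
  rwa [mul_assoc]

theorem PrimeDepthGE.of_ringEquiv {R S : Type*} [CommRing R] [CommRing S] (e : R ≃+* S)
    {p : Ideal S} {n : ℕ} (h : PrimeDepthGE (p.comap e) n) : PrimeDepthGE p n := by
  obtain ⟨rs, rfl, hmem, hreg⟩ := h
  refine ⟨rs.map e, by simp, ?_, ?_⟩
  · simpa using hmem
  · intro i hi g hg
    have key : ∀ x, e x ∈ Ideal.ofList ((rs.map e).take i) ↔ x ∈ Ideal.ofList (rs.take i) := by
      intro x
      have : Ideal.ofList ((rs.map e).take i) = (Ideal.ofList (rs.take i)).map e := by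
        rw [← List.map_take]
        exact (Ideal.map_ofList (e : R →+* S) _).symm
      rw [this, ← Ideal.mem_comap, Ideal.comap_map_of_bijective _ e.bijective]
    obtain ⟨g, rfl⟩ := e.surjective g
    rw [List.getElem_map, ← map_mul, key] at hg
    obtain ⟨u, hu, hug⟩ := hreg i (by simpa using hi) g hg
    exact ⟨e u, hu, by rwa [← map_mul, key]⟩

open Polynomial in
theorem IsRegularAt.map_C {R : Type*} [CommRing R] {p : Ideal R} [p.IsPrime] {Q : Ideal R[X]}
    (hQ : Q.comap C = p) {rs : List R} (h : IsRegularAt p rs) : IsRegularAt Q (rs.map C) := by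
  refine ⟨fun r hr => ?_, fun i hi g hg => ?_⟩
  · obtain ⟨r, hr', rfl⟩ := List.mem_map.mp hr
    rw [← Ideal.mem_comap, hQ]
    exact h.mem r hr'
  · rw [List.getElem_map] at hg
    rw [← List.map_take, ← Ideal.map_ofList, Ideal.mem_map_C_iff] at hg
    have := fun k => h.reg i (by simpa using hi) (g.coeff k) (by simpa using hg k)
    choose u hu hug using this
    refine ⟨C (∏ k ∈ g.support, u k), fun hmem => ?_, ?_⟩
    · rw [← Ideal.mem_comap, hQ, Ideal.IsPrime.prod_mem_iff] at hmem
      obtain ⟨k, -, hk⟩ := hmem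
      exact hu k hk
    · rw [← List.map_take, ← Ideal.map_ofList, Ideal.mem_map_C_iff]
      intro k
      rw [coeff_C_mul]
      by_cases hk : k ∈ g.support
      · exact Ideal.mem_of_dvd _ (mul_dvd_mul_right (Finset.dvd_prod_of_mem u hk) _) (hug k)
      · simp [notMem_support_iff.mp hk]

open Polynomial in
theorem eq_zero_of_isUnit_coeff_of_mul_eq_zero {S : Type*} [CommRing S] {f g : S[X]} {k : ℕ}
    (hunit : IsUnit (f.coeff k)) (h : f * g = 0) : g = 0 := by
  have hnzd : f ∈ nonZeroDivisors S[X] := by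
    by_contra hcon
    obtain ⟨a, ha, haf⟩ := Polynomial.notMem_nonZeroDivisors_iff.mp hcon
    apply ha
    have := congrArg (fun q => q.coeff k) haf
    simp only [coeff_smul, smul_eq_mul, coeff_zero] at this
    exact (hunit.mul_left_eq_zero).mp this
  exact (mul_left_mem_nonZeroDivisors_eq_zero_iff hnzd).mp h

open Polynomial in
theorem exists_notMem_C_mul_mem {R : Type*} [CommRing R] {p I : Ideal R} [p.IsPrime]
    {f g : R[X]} (hf : f ∉ p.map C) (hfg : f * g ∈ I.map C) :
    ∃ u ∉ p, C u * g ∈ I.map C := by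
  let S := Localization.AtPrime p ⧸ I.map (algebraMap R (Localization.AtPrime p))
  let φ : R →+* S := (Ideal.Quotient.mk _).comp (algebraMap R (Localization.AtPrime p))
  have hφ : ∀ r, φ r = 0 ↔ ∃ u ∉ p, u * r ∈ I := fun r => by
    rw [RingHom.comp_apply, Ideal.Quotient.eq_zero_iff_mem,
      IsLocalization.algebraMap_mem_map_algebraMap_iff p.primeCompl]
    rfl
  rw [Ideal.mem_map_C_iff] at hf
  push Not at hf
  obtain ⟨k, hk⟩ := hf
  have hunit : IsUnit (φ (f.coeff k)) :=
    (IsLocalization.map_units (Localization.AtPrime p) (⟨_, hk⟩ : p.primeCompl)).map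
      (Ideal.Quotient.mk (I.map (algebraMap R (Localization.AtPrime p))))
  have hg : g.map φ = 0 := by
    refine eq_zero_of_isUnit_coeff_of_mul_eq_zero (f := f.map φ) (k := k)
      (by rwa [coeff_map]) ?_
    rw [← Polynomial.map_mul]
    ext k
    rw [coeff_map, coeff_zero, hφ]
    exact ⟨1, p.one_notMem, by simpa using Ideal.mem_map_C_iff.mp hfg k⟩
  have : ∀ k, ∃ u ∉ p, u * g.coeff k ∈ I := fun k => by
    rw [← hφ, ← coeff_map, hg, coeff_zero]
  choose u hu hug using this
  refine ⟨∏ k ∈ g.support, u k, fun hmem => ?_, ?_⟩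
  · rw [Ideal.IsPrime.prod_mem_iff] at hmem
    obtain ⟨k, -, hk⟩ := hmem
    exact hu k hk
  · rw [Ideal.mem_map_C_iff]
    intro k
    rw [coeff_C_mul]
    by_cases hk : k ∈ g.support
    · exact Ideal.mem_of_dvd _ (mul_dvd_mul_right (Finset.dvd_prod_of_mem u hk) _) (hug k)
    · simp [notMem_support_iff.mp hk]

open Polynomial in
theorem PrimeDepthGE.succ_of_notMem_map_C {R : Type*} [CommRing R] {p : Ideal R} [p.IsPrime]
    {Q : Ideal R[X]} (hQ : Q.comap C = p) {n : ℕ} (h : PrimeDepthGE p n) {f : R[X]}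
    (hfQ : f ∈ Q) (hf : f ∉ p.map C) : PrimeDepthGE Q (n + 1) := by
  obtain ⟨rs, rfl, hrs⟩ := h
  have hC := hrs.map_C hQ
  refine ⟨rs.map C ++ [f], by simp, ?_, ?_⟩
  · intro r hr
    rw [List.mem_append, List.mem_singleton] at hr
    rcases hr with hr | rfl
    · exact hC.mem r hr
    · exact hfQ
  · intro i hi g hg
    rw [List.length_append, List.length_singleton] at hi
    rcases Nat.lt_or_ge i (rs.map C).length with hlt | hge
    · rw [List.take_append_of_le_length hlt.le] at hg ⊢
      rw [List.getElem_append_left hlt] at hg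
      exact hC.reg i hlt g hg
    · obtain rfl : i = (rs.map C).length := by omega
      rw [List.take_left] at hg ⊢
      rw [List.getElem_concat_length rfl] at hg
      rw [← Ideal.map_ofList] at hg ⊢
      obtain ⟨u, hu, hug⟩ := exists_notMem_C_mul_mem (p := p) hf hg
      exact ⟨C u, by rwa [← Ideal.mem_comap, hQ], hug⟩

open Polynomial Ideal IsLocalization in
attribute [local instance] Polynomial.algebra Polynomial.isLocalization in
theorem Polynomial.height_le_height_add_one {R : Type*} [CommRing R] [IsNoetherianRing R]
    (p : Ideal R) [p.IsPrime] (P : Ideal R[X]) [P.IsPrime] [P.LiesOver p] :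
    P.height ≤ p.height + 1 := by
  let Rₚ := Localization.AtPrime p
  set p' : Ideal Rₚ := p.map (algebraMap R Rₚ) with p'_def
  have : p'.IsMaximal := by
    rw [p'_def, Localization.AtPrime.map_eq_maximalIdeal]
    exact IsLocalRing.maximalIdeal.isMaximal Rₚ
  let P' : Ideal Rₚ[X] := P.map (algebraMap R[X] Rₚ[X])
  have disj : Disjoint (p.primeCompl.map C : Set R[X]) P := by
    refine Set.disjoint_left.mpr fun a ⟨b, hb⟩ ha ↦ hb.1 ?_
    rwa [SetLike.mem_coe, LiesOver.over (P := P) (p := p), mem_comap, algebraMap_eq, hb.2]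
  have : P'.IsPrime := isPrime_of_isPrime_disjoint (p.primeCompl.map C) _ P ‹_› disj
  have : P'.LiesOver p' := liesOver_of_isPrime_of_disjoint p.primeCompl _ _ disj
  have eq1 : p.height = p'.height := by
    rw [height_map_of_disjoint p.primeCompl]
    exact Disjoint.symm <| Set.disjoint_left.mpr fun _ a b ↦ b a
  have eq2 : P.height = P'.height := by
    rw [height_map_of_disjoint (Submonoid.map C <| p.primeCompl) _ disj]
  rw [eq1, eq2]
  refine (height_le_height_add_of_liesOver p' P').trans (add_le_add_right ?_ _)
  let _ : Field (Rₚ ⧸ p') := Quotient.field p'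
  let e : (Rₚ[X] ⧸ (p'.map (algebraMap Rₚ Rₚ[X]))) ≃+* (Rₚ ⧸ p')[X] :=
    (polynomialQuotientEquivQuotientPolynomial p').symm
  have : (P'.map (Ideal.Quotient.mk <| p'.map (algebraMap Rₚ Rₚ[X]))).IsPrime := by
    refine map_isPrime_of_surjective Quotient.mk_surjective ?_
    rw [mk_ker, LiesOver.over (P := P') (p := p')]
    exact map_comap_le
  rw [← e.height_map]
  have hp : (Ideal.map e (P'.map
      (Ideal.Quotient.mk <| p'.map (algebraMap Rₚ Rₚ[X])))).IsPrime := map_isPrime_of_equiv e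
  exact height_le_one_of_isPrincipal_of_mem_minimalPrimes (Ideal.map e _) (Ideal.map e _)
    (Ideal.minimalPrimes_eq_subsingleton_self.ge (Set.mem_singleton _))

open Polynomial in
theorem primeDepthGE_polynomial {R : Type*} [CommRing R] [IsNoetherianRing R]
    (h : ∀ (p : Ideal R) [p.IsPrime] (n : ℕ), n ≤ p.height → PrimeDepthGE p n)
    (Q : Ideal R[X]) [Q.IsPrime] (n : ℕ) (hn : n ≤ Q.height) : PrimeDepthGE Q n := by
  have : Q.LiesOver (Q.comap C) := ⟨rfl⟩
  have hp : (Q.comap C).IsPrime := Ideal.comap_isPrime C Q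
  by_cases hQ : Q ≤ (Q.comap C).map C
  · have hmk : Q.map (Ideal.Quotient.mk ((Q.comap C).map (algebraMap R R[X]))) = ⊥ := by
      rw [Ideal.map_eq_bot_iff_le_ker, Ideal.mk_ker]
      exact hQ
    have hht := Ideal.height_le_height_add_of_liesOver (Q.comap C) Q
    have : Nontrivial (R[X] ⧸ (Q.comap C).map (algebraMap R R[X])) :=
      Ideal.Quotient.nontrivial_iff.mpr
        (ne_top_of_le_ne_top ‹Q.IsPrime›.ne_top Ideal.map_comap_le)
    rw [hmk, Ideal.height_bot, add_zero] at hht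
    obtain ⟨rs, hlen, hrs⟩ := h (Q.comap C) n (hn.trans hht)
    exact ⟨rs.map C, by simpa, hrs.map_C rfl⟩
  · obtain ⟨f, hfQ, hf⟩ := SetLike.not_le_iff_exists.mp hQ
    cases n with
    | zero => exact primeDepthGE_zero Q
    | succ n =>
      have hht := hn.trans (Polynomial.height_le_height_add_one (Q.comap C) Q)
      rw [Nat.cast_add, Nat.cast_one] at hht
      exact (h (Q.comap C) n
        ((ENat.add_le_add_iff_right ENat.one_ne_top).mp hht)).succ_of_notMem_map_C rfl hfQ hf

theorem primeDepthGE_mvPolynomial {K : Type*} [Field K] (d : ℕ)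
    (p : Ideal (MvPolynomial (Fin d) K)) [p.IsPrime] (n : ℕ) (hn : n ≤ p.height) :
    PrimeDepthGE p n := by
  induction d generalizing n with
  | zero =>
    have e := (MvPolynomial.isEmptyRingEquiv K (Fin 0))
    have : (p.comap e.symm) = ⊥ :=
      ((Ideal.eq_bot_or_top _).resolve_right (Ideal.comap_isPrime e.symm p).ne_top)
    have h2 := e.symm.height_comap p
    rw [this, Ideal.height_bot] at h2
    rw [← h2] at hn
    obtain rfl : n = 0 := by simpa using hn
    exact primeDepthGE_zero p
  | succ d ih =>
    let e := (MvPolynomial.finSuccEquiv K d).toRingEquiv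
    have := Ideal.comap_isPrime e.symm p
    refine PrimeDepthGE.of_ringEquiv e.symm
      (primeDepthGE_polynomial (fun p _ n hn => ih p n hn) _ n ?_)
    rwa [e.symm.height_comap]

end

section

open RingTheory.Sequence Pointwise

theorem PrimeDepthGE.comap_aeval {R ι : Type*} [CommRing R] [Finite ι] {p : Ideal R} [p.IsPrime]
    {n : ℕ} (h : PrimeDepthGE p n) (a : ι → R) :
    PrimeDepthGE (p.comap (MvPolynomial.aeval a : MvPolynomial ι R →ₐ[R] R))
      (n + Nat.card ι) := by
  induction ι using Finite.induction_empty_option with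
  | of_equiv e ih =>
    have := ih (a ∘ e)
    rw [Nat.card_congr e] at this
    refine PrimeDepthGE.of_ringEquiv (MvPolynomial.renameEquiv R e).toRingEquiv ?_
    convert this using 1
    ext x
    simp [Ideal.mem_comap, MvPolynomial.aeval_rename]
  | h_empty =>
    simp only [Nat.card_of_isEmpty, add_zero]
    refine PrimeDepthGE.of_ringEquiv (MvPolynomial.isEmptyRingEquiv R PEmpty).symm ?_
    convert h
    ext x
    rw [Ideal.mem_comap, Ideal.mem_comap]
    refine (congrArg (· ∈ p) ?_).to_iff
    exact MvPolynomial.aeval_C a x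
  | @h_option σ _ ih =>
    refine PrimeDepthGE.of_ringEquiv (MvPolynomial.optionEquivLeft R σ).symm.toRingEquiv ?_
    rw [Finite.card_option, ← add_assoc]
    have h' := ih (fun i => a (some i))
    have := Ideal.comap_isPrime (MvPolynomial.aeval (fun i => a (some i)) :
      MvPolynomial σ R →ₐ[R] R) p
    have hX : (MvPolynomial.optionEquivLeft R σ).symm Polynomial.X = MvPolynomial.X none := by
      rw [AlgEquiv.symm_apply_eq, MvPolynomial.optionEquivLeft_X_none]
    have hC : ∀ x, MvPolynomial.aeval a
        ((MvPolynomial.optionEquivLeft R σ).symm (Polynomial.C x)) =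
          MvPolynomial.aeval (fun i => a (some i)) x := fun x => by
      induction x using MvPolynomial.induction_on with
      | C r =>
        have : (MvPolynomial.optionEquivLeft R σ).symm (Polynomial.C (MvPolynomial.C r)) =
            MvPolynomial.C r := by
          rw [AlgEquiv.symm_apply_eq, MvPolynomial.optionEquivLeft_C]
        simp [this]
      | add x y hx hy => simp only [map_add, hx, hy]
      | mul_X x i hx =>
        have : (MvPolynomial.optionEquivLeft R σ).symm (Polynomial.C (MvPolynomial.X i)) =
            MvPolynomial.X (some i) := by
          rw [AlgEquiv.symm_apply_eq, MvPolynomial.optionEquivLeft_X_some]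
        simp only [map_mul, this, hx, MvPolynomial.aeval_X]
    refine h'.succ_of_notMem_map_C (f := Polynomial.X - Polynomial.C (MvPolynomial.C (a none)))
      ?_ ?_ ?_
    · ext x
      simp only [Ideal.mem_comap]
      exact (congrArg (· ∈ p) (hC x)).to_iff
    · rw [Ideal.mem_comap, Ideal.mem_comap]
      convert p.zero_mem
      rw [map_sub, map_sub]
      refine sub_eq_zero.mpr ?_
      refine (congrArg _ hX).trans (((MvPolynomial.aeval_X a none)).trans ?_)
      refine Eq.trans ?_ (hC _).symm
      simp
    · intro hf
      have := Ideal.mem_map_C_iff.mp hf 1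
      rw [Polynomial.coeff_sub, Polynomial.coeff_X_one, Polynomial.coeff_C_succ, sub_zero] at this
      exact (Ideal.ne_top_iff_one _).mp (Ideal.IsPrime.ne_top ‹_›) this

end

theorem minorsIdeal_map {R S α β : Type*} [CommRing R] [CommRing S] (φ : R →+* S) (t : ℕ)
    (A : Matrix α β R) : (minorsIdeal t A).map φ = minorsIdeal t (A.map φ) := by
  rw [minorsIdeal, minorsIdeal, Ideal.map_span]
  congr 1
  ext d
  simp only [Set.mem_image, Set.mem_ofPred_eq]
  constructor
  · rintro ⟨_, ⟨f, g, hf, hg, rfl⟩, rfl⟩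
    exact ⟨f, g, hf, hg, by rw [φ.map_det, RingHom.mapMatrix_apply, submatrix_map]⟩
  · rintro ⟨f, g, hf, hg, rfl⟩
    exact ⟨_, ⟨f, g, hf, hg, rfl⟩, by rw [φ.map_det, RingHom.mapMatrix_apply, submatrix_map]⟩

theorem minorsIdeal_zero {R α β : Type*} [CommRing R] (A : Matrix α β R) :
    minorsIdeal 0 A = ⊤ :=
  (Ideal.eq_top_iff_one _).mpr <| Ideal.subset_span
    ⟨Fin.elim0, Fin.elim0, fun x => x.elim0, fun x => x.elim0, by simp⟩

theorem minorsIdeal_transpose {R α β : Type*} [CommRing R] (t : ℕ) (A : Matrix α β R) :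
    minorsIdeal t Aᵀ = minorsIdeal t A := by
  rw [minorsIdeal, minorsIdeal]
  congr 1
  ext d
  constructor
  all_goals
    rintro ⟨f, g, hf, hg, rfl⟩
    exact ⟨g, f, hg, hf, by rw [← det_transpose]; rfl⟩

theorem minorsIdeal_submatrix_le {R α β α' β' : Type*} [CommRing R] (t : ℕ)
    (A : Matrix α β R) {e : α' → α} {e' : β' → β} (he : Function.Injective e)
    (he' : Function.Injective e') : minorsIdeal t (A.submatrix e e') ≤ minorsIdeal t A := by
  refine Ideal.span_le.mpr ?_
  rintro _ ⟨f, g, hf, hg, rfl⟩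
  exact Ideal.subset_span ⟨e ∘ f, e' ∘ g, he.comp hf, he'.comp hg, rfl⟩

theorem minorsIdeal_reindex {R α β α' β' : Type*} [CommRing R] (t : ℕ)
    (A : Matrix α β R) (e : α ≃ α') (e' : β ≃ β') :
    minorsIdeal t (A.reindex e e') = minorsIdeal t A := by
  refine le_antisymm (minorsIdeal_submatrix_le t A e.symm.injective e'.symm.injective) ?_
  have := minorsIdeal_submatrix_le t (A.reindex e e') e.injective e'.injective
  simpa using this

theorem minorsIdeal_mul_le_right {R α α' β : Type*} [CommRing R] [Fintype α] (t : ℕ)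
    (P : Matrix α' α R) (A : Matrix α β R) : minorsIdeal t (P * A) ≤ minorsIdeal t A := by
  classical
  refine Ideal.span_le.mpr ?_
  rintro _ ⟨f, g, hf, hg, rfl⟩
  have hrow : (P * A).submatrix f g = fun i => ∑ k, P (f i) k • fun j => A k (g j) := by
    ext i j
    simp [Matrix.mul_apply]
  rw [hrow]
  have h1 := (detRowAlternating (n := Fin t) (R := R)).toMultilinearMap.map_sum
    (fun i k => P (f i) k • fun j => A k (g j))
  simp only [MultilinearMap.map_smul_univ] at h1
  change detRowAlternating _ ∈ _
  refine (congrArg (· ∈ minorsIdeal t A) h1).mpr (Ideal.sum_mem _ fun r _ => ?_)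
  rw [smul_eq_mul]
  refine Ideal.mul_mem_left _ _ ?_
  change (A.submatrix r g).det ∈ _
  by_cases hr : Function.Injective r
  · exact Ideal.subset_span ⟨r, g, hr, hg, rfl⟩
  · obtain ⟨i, j, hij, hne⟩ := Function.not_injective_iff.mp hr
    rw [det_zero_of_row_eq hne (by ext k; simp [hij])]
    exact zero_mem _

theorem minorsIdeal_mul_le_left {R α β β' : Type*} [CommRing R] [Fintype β] (t : ℕ)
    (A : Matrix α β R) (P : Matrix β β' R) : minorsIdeal t (A * P) ≤ minorsIdeal t A := by
  rw [← minorsIdeal_transpose, transpose_mul, ← minorsIdeal_transpose t A]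
  exact minorsIdeal_mul_le_right t _ _

theorem minorsIdeal_mul_mul {R α β : Type*} [CommRing R] [Fintype α] [Fintype β]
    [DecidableEq α] [DecidableEq β] (t : ℕ) {P P' : Matrix α α R} (hP : P' * P = 1)
    {Q Q' : Matrix β β R} (hQ : Q * Q' = 1) (A : Matrix α β R) :
    minorsIdeal t (P * A * Q) = minorsIdeal t A := by
  refine le_antisymm ((minorsIdeal_mul_le_left t _ _).trans (minorsIdeal_mul_le_right t _ _)) ?_
  have : A = P' * (P * A * Q) * Q' := by
    rw [Matrix.mul_assoc P', Matrix.mul_assoc _ Q, hQ, Matrix.mul_one, ← Matrix.mul_assoc, hP,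
      Matrix.one_mul]
  conv_lhs => rw [this]
  exact (minorsIdeal_mul_le_left t _ _).trans (minorsIdeal_mul_le_right t _ _)

/-- Block Gaussian elimination for the ideals of minors. -/
theorem minorsIdeal_fromBlocks {R a α β : Type*} [CommRing R] [Fintype a] [Fintype α] [Fintype β]
    [DecidableEq a] [DecidableEq α] [DecidableEq β] (t : ℕ) (U : Matrix a a R) (hU : IsUnit U.det)
    (V : Matrix a β R) (W : Matrix α a R) (Z : Matrix α β R) :
    minorsIdeal t (fromBlocks U V W (Z + W * U⁻¹ * V)) =
      minorsIdeal t (fromBlocks (1 : Matrix a a R) 0 0 Z) := by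
  have h1 : U * U⁻¹ = 1 := mul_nonsing_inv U hU
  have h2 : U⁻¹ * U = 1 := nonsing_inv_mul U hU
  have key : fromBlocks U V W (Z + W * U⁻¹ * V) =
      (fromBlocks 1 0 (W * U⁻¹) 1 : Matrix (a ⊕ α) (a ⊕ α) R) *
        (fromBlocks 1 0 0 Z : Matrix (a ⊕ α) (a ⊕ β) R) *
        (fromBlocks U V 0 1 : Matrix (a ⊕ β) (a ⊕ β) R) := by
    simp [fromBlocks_multiply, Matrix.mul_assoc, h2, add_comm]
  rw [key]
  refine minorsIdeal_mul_mul t (P' := fromBlocks 1 0 (-(W * U⁻¹)) 1)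
    (Q' := fromBlocks U⁻¹ (-(U⁻¹ * V)) 0 1) ?_ ?_ _
  · simp [fromBlocks_multiply, fromBlocks_one]
  · simp [fromBlocks_multiply, ← Matrix.mul_assoc, h1, fromBlocks_one]

theorem le_height_of_le_idealHeight {R : Type*} [CommRing R] {I p : Ideal R} [p.IsPrime]
    (hp : I ≤ p) {n : ℕ∞} (h : n ≤ idealHeight I) : n ≤ p.height := by
  rw [PrimeSpectrum.height_eq_orderHeight (⟨p, ‹_›⟩ : PrimeSpectrum R)]
  exact h.trans (iInf₂_le (⟨p, ‹_›⟩ : PrimeSpectrum R) hp)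

section

open RingTheory.Sequence Pointwise

theorem localDepthGE_of_forall_mem {B : Type*} [CommRing B] {c Q : Ideal B} [Q.IsPrime]
    {rs : List B} (hmem : ∀ r ∈ rs, r ∈ Q)
    (hreg : ∀ (i : ℕ) (_ : i < rs.length) (g : B), rs[i] * g ∈ Ideal.ofList (rs.take i) ⊔ c →
      ∃ u ∉ Q, u * g ∈ Ideal.ofList (rs.take i) ⊔ c) :
    LocalDepthGE c Q rs.length := by
  refine ⟨rs.map (algebraMap B _), by simp, ?_, ?_⟩
  · intro x hx
    obtain ⟨r, hr, rfl⟩ := List.mem_map.mp hx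
    exact (IsLocalization.AtPrime.to_map_mem_maximal_iff _ Q r).mpr (hmem r hr)
  · rw [isWeaklyRegular_iff]
    intro i hi
    have hi' : i < rs.length := by simpa using hi
    rw [isSMulRegular_quotient_iff_mem_of_smul_mem]
    intro x hx
    obtain ⟨x, rfl⟩ := Ideal.Quotient.mk_surjective x
    obtain ⟨b, s, rfl⟩ := IsLocalization.exists_mk'_eq Q.primeCompl x
    rw [List.getElem_map] at hx
    rw [← List.map_take, ← Ideal.map_ofList, Ideal.smul_top_eq_map, Submodule.restrictScalars_mem,
      Ideal.Quotient.algebraMap_eq] at hx ⊢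
    change Ideal.Quotient.mk _ (algebraMap B (Localization.AtPrime Q) rs[i] *
      IsLocalization.mk' _ b s) ∈ _ at hx
    rw [Ideal.mem_quotient_iff_mem_sup,
      ← Ideal.map_sup, IsLocalization.mul_mk'_eq_mk'_of_mul,
      IsLocalization.mk'_mem_map_algebraMap_iff] at hx
    obtain ⟨u, hu, hub⟩ := hx
    obtain ⟨v, hv, hvb⟩ := hreg i hi' (u * b) (by convert hub using 1; ring)
    rw [Ideal.mem_quotient_iff_mem_sup, ← Ideal.map_sup, IsLocalization.mk'_mem_map_algebraMap_iff]
    refine ⟨v * u, Q.primeCompl.mul_mem hv hu, ?_⟩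
    rwa [mul_assoc]

/-- A sequence regular at `q` stays regular on quotients that are flat over the localization. -/
theorem IsRegularAt.mem_sup_of_flat {C S D : Type*} [CommRing C] [CommRing S] [CommRing D]
    {q : Ideal C} [q.IsPrime] [Algebra C S] [IsLocalization.AtPrime S q] [Algebra S D]
    {rs : List C} (h : IsRegularAt q rs) (c : Ideal D) [Module.Flat S (D ⧸ c)] {i : ℕ}
    (hi : i < rs.length) {d : D} {φ : C →+* D} (hφ : φ = (algebraMap S D).comp (algebraMap C S))
    (hd : φ rs[i] * d ∈ (Ideal.ofList (rs.take i)).map φ ⊔ c) :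
    d ∈ (Ideal.ofList (rs.take i)).map φ ⊔ c := by
  have hreg := (h.isWeaklyRegular (S := S)).isWeaklyRegular_rTensor (M₂ := D ⧸ c)
  have hreg' := ((TensorProduct.lid S (D ⧸ c)).isWeaklyRegular_congr _).mp hreg
  rw [isWeaklyRegular_iff] at hreg'
  have := hreg' i (by simpa)
  rw [isSMulRegular_quotient_iff_mem_of_smul_mem] at this
  have key : ∀ x : D, Ideal.Quotient.mk c x ∈
      Ideal.ofList ((rs.map (algebraMap C S)).take i) • (⊤ : Submodule S (D ⧸ c)) ↔
      x ∈ (Ideal.ofList (rs.take i)).map φ ⊔ c := fun x => by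
    rw [← List.map_take, ← Ideal.map_ofList, Ideal.smul_top_eq_map, Submodule.restrictScalars_mem,
      IsScalarTower.algebraMap_eq S D (D ⧸ c), ← Ideal.map_map, Ideal.Quotient.algebraMap_eq,
      Ideal.mem_quotient_iff_mem_sup, Ideal.map_map, ← hφ]
  rw [← key] at hd ⊢
  refine this _ ?_
  convert hd using 1
  rw [map_mul, hφ, List.getElem_map, Algebra.smul_def]
  rfl

attribute [local instance] MvPolynomial.algebraMvPolynomial in
theorem IsRegularAt.localDepthGE {C S B s : Type*} [CommRing C] [CommRing S] [CommRing B]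
    {q : Ideal C} [q.IsPrime] [Algebra C S] [IsLocalization.AtPrime S q]
    {rs : List C} (h : IsRegularAt q rs) (e : B ≃+* MvPolynomial s C) {c Q : Ideal B} [Q.IsPrime]
    (hQ : ∀ x, e.symm (MvPolynomial.C x) ∈ Q ↔ x ∈ q)
    (hflat : Module.Flat S (MvPolynomial s S ⧸
      (c.map e).map (MvPolynomial.map (algebraMap C S)))) :
    LocalDepthGE c Q rs.length := by
  have hlen : rs.length = (rs.map (fun x => e.symm (MvPolynomial.C x))).length := by simp
  rw [hlen]
  refine localDepthGE_of_forall_mem ?_ ?_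
  · intro r hr
    obtain ⟨x, hx, rfl⟩ := List.mem_map.mp hr
    exact (hQ x).mpr (h.mem x hx)
  · intro i hi g hg
    rw [List.getElem_map] at hg
    have hi' : i < rs.length := by simpa using hi
    let φ : C →+* MvPolynomial s S := (MvPolynomial.map (algebraMap C S)).comp MvPolynomial.C
    have hideal : ((Ideal.ofList ((rs.map (fun x => e.symm (MvPolynomial.C x))).take i) ⊔ c).map
        e) = (Ideal.ofList (rs.take i)).map MvPolynomial.C ⊔ c.map e := by
      rw [Ideal.map_sup]
      congr 1
      refine (Ideal.map_ofList (e : B →+* MvPolynomial s C) _).trans ?_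
      rw [Ideal.map_ofList, ← List.map_take, List.map_map]
      congr 2
      ext1 x
      simp
    have hideal' : ((Ideal.ofList (rs.take i)).map MvPolynomial.C ⊔ c.map e).map
        (MvPolynomial.map (algebraMap C S)) = (Ideal.ofList (rs.take i)).map φ ⊔
          (c.map e).map (MvPolynomial.map (algebraMap C S)) := by
      rw [Ideal.map_sup, Ideal.map_map]
    have h1 := Ideal.mem_map_of_mem e hg
    rw [hideal, map_mul, RingEquiv.apply_symm_apply] at h1
    have h2 := Ideal.mem_map_of_mem (MvPolynomial.map (algebraMap C S)) h1
    rw [hideal', map_mul] at h2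
    have h3 := h.mem_sup_of_flat (S := S) _ hi' (φ := φ)
      (by ext1 x; simp [φ, MvPolynomial.algebraMap_eq]) h2
    rw [← hideal', ← MvPolynomial.algebraMap_def,
      IsLocalization.algebraMap_mem_map_algebraMap_iff
        (q.primeCompl.map (MvPolynomial.C (σ := s)))] at h3
    obtain ⟨_, ⟨u, hu, rfl⟩, hug⟩ := h3
    refine ⟨e.symm (MvPolynomial.C u), fun hmem => hu ((hQ u).mp hmem), ?_⟩
    rw [← hideal] at hug
    have h4 := Ideal.mem_map_of_mem e.symm hug
    rw [Ideal.map_symm, Ideal.comap_map_of_bijective _ e.bijective, map_mul,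
      RingEquiv.symm_apply_apply] at h4
    exact h4

end

section

open TensorProduct

theorem flat_mvPolynomial_quotient_map {K S s : Type*} [Field K] [CommRing S] [Algebra K S]
    (b : Ideal (MvPolynomial s K)) :
    Module.Flat S (MvPolynomial s S ⧸ b.map (MvPolynomial.map (algebraMap K S))) := by
  let e₁ := Algebra.TensorProduct.tensorQuotientEquiv (R := K) S (MvPolynomial s K) S b
  let e₂ := Ideal.quotientEquivAlg
    (b.map (Algebra.TensorProduct.includeRight : MvPolynomial s K →ₐ[K] S ⊗[K] MvPolynomial s K))
    (b.map (MvPolynomial.map (algebraMap K S)))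
    (MvPolynomial.algebraTensorAlgEquiv K S (σ := s)) (by
      have h : (MvPolynomial.map (algebraMap K S) : MvPolynomial s K →+* MvPolynomial s S) =
          ((MvPolynomial.algebraTensorAlgEquiv K S (σ := s)) :
            S ⊗[K] MvPolynomial s K →+* MvPolynomial s S).comp
          (Algebra.TensorProduct.includeRight :
            MvPolynomial s K →ₐ[K] S ⊗[K] MvPolynomial s K).toRingHom := by
        ext x <;> simp
      rw [h, ← Ideal.map_map]
      rfl)
  exact Module.Flat.of_linearEquiv (e₁.trans e₂).symm.toLinearEquiv

/-- Translation of the variables as an automorphism of a polynomial ring. -/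
noncomputable def MvPolynomial.translate {S s : Type*} [CommRing S] (w : s → S) :
    MvPolynomial s S ≃ₐ[S] MvPolynomial s S :=
  AlgEquiv.ofAlgHom (MvPolynomial.aeval fun i => MvPolynomial.X i + MvPolynomial.C (w i))
    (MvPolynomial.aeval fun i => MvPolynomial.X i - MvPolynomial.C (w i))
    (by ext i; simp [MvPolynomial.algebraMap_eq]) (by ext i; simp [MvPolynomial.algebraMap_eq])

theorem flat_quotient_minorsIdeal_pow {K S a α β : Type*} [Field K] [CommRing S] [Algebra K S]
    [Fintype a] [Fintype α] [Fintype β] [DecidableEq a] (t k : ℕ)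
    (U : Matrix a a S) (hU : IsUnit U.det) (V : Matrix a β S) (W : Matrix α a S) :
    Module.Flat S (MvPolynomial (α × β) S ⧸
      minorsIdeal t (fromBlocks (U.map MvPolynomial.C) (V.map MvPolynomial.C)
        (W.map MvPolynomial.C) (Matrix.of fun i j => MvPolynomial.X (i, j))) ^ k) := by
  classical
  let P := MvPolynomial (α × β) S
  let Z : Matrix α β P := Matrix.of fun i j => MvPolynomial.X (i, j)
  let C : S →+* P := MvPolynomial.C
  let σ := MvPolynomial.translate (fun ij : α × β => (W * U⁻¹ * V) ij.1 ij.2)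
  let b : Ideal (MvPolynomial (α × β) K) :=
    minorsIdeal t (fromBlocks (1 : Matrix a a _) 0 0 (Matrix.of fun i j => MvPolynomial.X (i, j)))
  have hUC : IsUnit (U.map C).det := by
    have := hU.map C
    rwa [C.map_det] at this
  have hinv : (U.map C)⁻¹ = U⁻¹.map C := by
    refine inv_eq_left_inv ?_
    rw [← Matrix.map_mul, nonsing_inv_mul U hU]
    simp
  have hσX : (fromBlocks (U.map C) (V.map C) (W.map C) Z).map σ =
      fromBlocks (U.map C) (V.map C) (W.map C)
        (Z + W.map C * (U.map C)⁻¹ * V.map C) := by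
    have hC : ∀ x, σ (C x) = C x := fun x => σ.commutes x
    rw [hinv, ← Matrix.map_mul, ← Matrix.map_mul, fromBlocks_map]
    congr 1
    · ext i j; simp [hC]
    · ext i j; simp [hC]
    · ext i j; simp [hC]
    · ext1 i j
      exact (MvPolynomial.aeval_X _ (i, j))
  have hσ : (minorsIdeal t (fromBlocks (U.map C) (V.map C) (W.map C) Z) ^ k).map
      (σ : P →+* P) = (b ^ k).map (MvPolynomial.map (algebraMap K S)) := by
    rw [Ideal.map_pow, Ideal.map_pow, minorsIdeal_map, minorsIdeal_map]
    congr 1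
    refine (congrArg (minorsIdeal t) hσX).trans ((minorsIdeal_fromBlocks t _ hUC _ _ _).trans ?_)
    congr 1
    rw [fromBlocks_map]
    congr 1
    · simp
    · ext; simp
    · ext; simp
    · ext1 i j; simp [Z]
  have := flat_mvPolynomial_quotient_map (S := S) (b ^ k)
  exact Module.Flat.of_linearEquiv (Ideal.quotientEquivAlg _ _ σ hσ.symm).toLinearEquiv

end

/-- The positions of a block matrix, with those of the lower right block split off. -/
def blockPositionsEquiv (a α β : Type*) :
    (a ⊕ α) × (a ⊕ β) ≃ (α × β) ⊕ ((a × a ⊕ a × β) ⊕ α × a) where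
  toFun
    | (.inl i, .inl j) => .inr (.inl (.inl (i, j)))
    | (.inl i, .inr j) => .inr (.inl (.inr (i, j)))
    | (.inr i, .inl j) => .inr (.inr (i, j))
    | (.inr i, .inr j) => .inl (i, j)
  invFun
    | .inr (.inl (.inl (i, j))) => (.inl i, .inl j)
    | .inr (.inl (.inr (i, j))) => (.inl i, .inr j)
    | .inr (.inr (i, j)) => (.inr i, .inl j)
    | .inl (i, j) => (.inr i, .inr j)
  left_inv := by rintro ⟨_ | _, _ | _⟩ <;> rfl
  right_inv := by rintro (_ | (_ | _) | _) <;> rfl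

theorem IsRegularAt.localDepthGE_minorsIdeal_pow {K C S B a α β μ ν : Type*} [Field K] [CommRing C]
    [CommRing S] [CommRing B] [Fintype a] [Fintype α] [Fintype β] [DecidableEq a] {q : Ideal C}
    [q.IsPrime] [Algebra C S] [IsLocalization.AtPrime S q] [Algebra K S] {rs : List C}
    (h : IsRegularAt q rs) (e : B ≃+* MvPolynomial (α × β) C) {Q : Ideal B} [Q.IsPrime]
    (hQ : ∀ x, e.symm (MvPolynomial.C x) ∈ Q ↔ x ∈ q) (e₁ : μ ≃ a ⊕ α) (e₂ : ν ≃ a ⊕ β)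
    {X : Matrix μ ν B} {U : Matrix a a C} {V : Matrix a β C} {W : Matrix α a C}
    (hU : U.det ∉ q) (hX : (X.map e).reindex e₁ e₂ = fromBlocks (U.map MvPolynomial.C)
      (V.map MvPolynomial.C) (W.map MvPolynomial.C) (Matrix.of fun i j => MvPolynomial.X (i, j)))
    (t k : ℕ) : LocalDepthGE (minorsIdeal t X ^ k) Q rs.length := by
  refine h.localDepthGE (S := S) e hQ ?_
  let φ := algebraMap C S
  have hUφ : IsUnit (U.map φ).det := by
    have := IsLocalization.map_units S (⟨U.det, hU⟩ : q.primeCompl)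
    rwa [RingHom.map_det] at this
  have hflat := flat_quotient_minorsIdeal_pow (K := K) t k (U.map φ) hUφ (V.map φ) (W.map φ)
  have hJ : ((minorsIdeal t X ^ k).map (e : B →+* _)).map (MvPolynomial.map φ) =
      minorsIdeal t (fromBlocks ((U.map φ).map MvPolynomial.C) ((V.map φ).map MvPolynomial.C)
        ((W.map φ).map MvPolynomial.C) (Matrix.of fun i j => MvPolynomial.X (i, j))) ^ k := by
    rw [Ideal.map_pow, Ideal.map_pow, minorsIdeal_map, ← minorsIdeal_reindex t _ e₁ e₂]
    rw [RingEquiv.coe_toRingHom, hX, minorsIdeal_map, fromBlocks_map]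
    congr 3 <;> ext1 i j <;> simp
  rw [← hJ] at hflat
  exact hflat

theorem localDepthGE_minorsIdeal_pow {K R a α β μ ν : Type*} [Field K] [CommRing R] [Algebra K R]
    [Fintype a] [Fintype α] [Fintype β] [DecidableEq a] (e₁ : μ ≃ a ⊕ α) (e₂ : ν ≃ a ⊕ β)
    (A : Matrix μ ν R) {p : Ideal R} [p.IsPrime]
    (hdet : (A.submatrix (fun i => e₁.symm (.inl i)) (fun i => e₂.symm (.inl i))).det ∉ p)
    (hp : PrimeDepthGE p (Nat.card (α × β))) {Q : Ideal (MvPolynomial (μ × ν) R)} [Q.IsPrime]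
    (hQ : Q = p.comap (MvPolynomial.aeval fun ij : μ × ν => A ij.1 ij.2)) (t k : ℕ) :
    LocalDepthGE (minorsIdeal t (Matrix.of fun i j => MvPolynomial.X (i, j)) ^ k) Q
      (Nat.card (μ × ν)) := by
  let τ := (a × a ⊕ a × β) ⊕ α × a
  let ε : μ × ν ≃ (α × β) ⊕ τ := (e₁.prodCongr e₂).trans (blockPositionsEquiv a α β)
  let e : MvPolynomial (μ × ν) R ≃ₐ[R] MvPolynomial (α × β) (MvPolynomial τ R) :=
    (MvPolynomial.renameEquiv R ε).trans (MvPolynomial.sumAlgEquiv R (α × β) τ)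
  have he_inl : ∀ x, e (MvPolynomial.X (ε.symm (.inl x))) = MvPolynomial.X x := fun x => by
    change MvPolynomial.sumAlgEquiv R (α × β) τ (MvPolynomial.rename ε _) = _
    rw [MvPolynomial.rename_X, Equiv.apply_symm_apply, MvPolynomial.sumAlgEquiv_X_inl]
  have he_inr : ∀ x, e (MvPolynomial.X (ε.symm (.inr x))) = MvPolynomial.C (MvPolynomial.X x) :=
    fun x => by
      change MvPolynomial.sumAlgEquiv R (α × β) τ (MvPolynomial.rename ε _) = _
      rw [MvPolynomial.rename_X, Equiv.apply_symm_apply, MvPolynomial.sumAlgEquiv_X_inr]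
  let v : τ → R := fun x => A (ε.symm (.inr x)).1 (ε.symm (.inr x)).2
  let q : Ideal (MvPolynomial τ R) := p.comap (MvPolynomial.aeval v : MvPolynomial τ R →ₐ[R] R)
  have hq : q.IsPrime := Ideal.comap_isPrime _ p
  obtain ⟨rs, hlen, hrs⟩ := hp.comap_aeval v
  have hcard : rs.length = Nat.card (μ × ν) := by
    rw [hlen, Nat.card_congr ε, Nat.card_sum (α := α × β)]
  rw [← hcard]
  refine hrs.localDepthGE_minorsIdeal_pow (K := K) (S := Localization.AtPrime q) e.toRingEquiv ?_
    e₁ e₂ (U := Matrix.of fun i j => MvPolynomial.X (.inl (.inl (i, j))))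
    (V := Matrix.of fun i j => MvPolynomial.X (.inl (.inr (i, j))))
    (W := Matrix.of fun i j => MvPolynomial.X (.inr (i, j))) ?_ ?_ t k
  · have hcomp : ∀ x, MvPolynomial.aeval (fun ij : μ × ν => A ij.1 ij.2)
        (e.symm (MvPolynomial.C x)) = MvPolynomial.aeval v x := fun x => by
      induction x using MvPolynomial.induction_on with
      | C r =>
        have : e.symm (MvPolynomial.C (MvPolynomial.C r)) = MvPolynomial.C r := by
          rw [AlgEquiv.symm_apply_eq]
          exact (e.commutes r).symm
        rw [this, MvPolynomial.aeval_C, MvPolynomial.aeval_C]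
      | add x y hx hy => simp only [map_add, hx, hy]
      | mul_X x i hx =>
        have : e.symm (MvPolynomial.C (MvPolynomial.X i)) = MvPolynomial.X (ε.symm (.inr i)) := by
          rw [AlgEquiv.symm_apply_eq, he_inr]
        simp only [map_mul, this, hx, MvPolynomial.aeval_X]
        rfl
    intro x
    rw [hQ]
    exact (congrArg (· ∈ p) (hcomp x)).to_iff
  · intro hmem
    refine hdet ?_
    have := Ideal.mem_comap.mp hmem
    rw [AlgHom.map_det] at this
    convert this using 2
    ext i j
    simp [v, ε, blockPositionsEquiv]
  · ext1 i j
    rcases i with i | i <;> rcases j with j | j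
    · exact he_inr (.inl (.inl (i, j)))
    · exact he_inr (.inl (.inr (i, j)))
    · exact he_inr (.inr (i, j))
    · exact he_inl (i, j)

section

open TensorProduct

/-- `J ⊗ R → R` is injective for a surjection `φ : B → R` with `J ∩ ker φ ≤ J * ker φ`. -/
theorem injective_lid_comp_map_subtype {B R : Type*} [CommRing B] [CommRing R] [Algebra B R]
    (hφ : Function.Surjective (algebraMap B R)) (J : Ideal B)
    (h : J ⊓ RingHom.ker (algebraMap B R) ≤ J * RingHom.ker (algebraMap B R)) :
    Function.Injective ((TensorProduct.lid B R).toLinearMap.comp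
      (TensorProduct.map (Submodule.subtype J) LinearMap.id)) := by
  have hrep : ∀ z : TensorProduct B J R, ∃ x : J, z = x ⊗ₜ[B] (1 : R) := fun z => by
    induction z with
    | zero => exact ⟨0, (TensorProduct.zero_tmul _ _).symm⟩
    | tmul x r =>
      obtain ⟨b, rfl⟩ := hφ r
      exact ⟨b • x, by rw [TensorProduct.smul_tmul, Algebra.smul_def, mul_one]⟩
    | add z w hz hw =>
      obtain ⟨x, rfl⟩ := hz
      obtain ⟨y, rfl⟩ := hw
      exact ⟨x + y, (TensorProduct.add_tmul _ _ _).symm⟩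
  let ι : J →ₗ[B] TensorProduct B J R := (TensorProduct.mk B J R).flip 1
  have hzero : J * RingHom.ker (algebraMap B R) ≤ (LinearMap.ker ι).map J.subtype := by
    refine Ideal.mul_le.mpr fun x hx y hy => ⟨y • ⟨x, hx⟩, ?_, mul_comm y x⟩
    change (y • (⟨x, hx⟩ : J)) ⊗ₜ[B] (1 : R) = 0
    rw [TensorProduct.smul_tmul, Algebra.smul_def, RingHom.mem_ker.mp hy, zero_mul,
      TensorProduct.tmul_zero]
  rw [injective_iff_map_eq_zero]
  intro z hz
  obtain ⟨⟨x, hx⟩, rfl⟩ := hrep z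
  obtain ⟨y, hy, rfl⟩ := hzero (h ⟨hx, by
    rw [SetLike.mem_coe, RingHom.mem_ker, Algebra.algebraMap_eq_smul_one]
    exact hz⟩)
  exact hy

theorem range_lid_comp_map_subtype {B R : Type*} [CommRing B] [CommRing R] [Algebra B R]
    (hφ : Function.Surjective (algebraMap B R)) (J : Ideal B) :
    Set.range ((TensorProduct.lid B R).toLinearMap.comp
      (TensorProduct.map (Submodule.subtype J) LinearMap.id)) =
      (J.map (algebraMap B R) : Set R) := by
  ext r
  rw [SetLike.mem_coe, Ideal.mem_map_iff_of_surjective _ hφ]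
  constructor
  · rintro ⟨z, rfl⟩
    rw [← Ideal.mem_map_iff_of_surjective _ hφ]
    induction z with
    | zero => rw [map_zero]; exact zero_mem _
    | tmul x r =>
      change (x : B) • r ∈ _
      rw [Algebra.smul_def]
      exact Ideal.mul_mem_right _ _ (Ideal.mem_map_of_mem _ x.2)
    | add z w hz hw => rw [map_add]; exact add_mem hz hw
  · rintro ⟨x, hx, rfl⟩
    exact ⟨⟨x, hx⟩ ⊗ₜ[B] 1, (Algebra.algebraMap_eq_smul_one x).symm⟩

/-- The kernel of evaluation at `v` is generated by the elements `X i - v i`. -/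
theorem ker_aeval_eq_ofList {R σ : Type*} [CommRing R] [Fintype σ] (v : σ → R) :
    RingHom.ker (MvPolynomial.aeval v : MvPolynomial σ R →ₐ[R] R).toRingHom =
      Ideal.ofList (Finset.univ.toList.map fun i => MvPolynomial.X i - MvPolynomial.C (v i)) := by
  set N := Ideal.ofList (Finset.univ.toList.map
    fun i => (MvPolynomial.X i - MvPolynomial.C (v i) : MvPolynomial σ R)) with hN
  have hmem : ∀ i, MvPolynomial.X i - MvPolynomial.C (v i) ∈ N := fun i =>
    Ideal.subset_span (List.mem_map.mpr ⟨i, by simp, rfl⟩)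
  apply le_antisymm
  · have hsub : ∀ f, f - MvPolynomial.C (MvPolynomial.aeval v f) ∈ N := fun f => by
      induction f using MvPolynomial.induction_on with
      | C r => simp
      | add x y hx hy =>
        have := add_mem hx hy
        rw [map_add, map_add]
        convert this using 1
        ring
      | mul_X x i hx =>
        have := add_mem (N.mul_mem_right (MvPolynomial.X i) hx)
          (N.mul_mem_left (MvPolynomial.C (MvPolynomial.aeval v x)) (hmem i))
        rw [map_mul, map_mul, MvPolynomial.aeval_X]
        convert this using 1
        ring
    intro f hf
    have h0 : MvPolynomial.aeval v f = 0 := hf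
    have := hsub f
    rwa [h0, map_zero, sub_zero] at this
  · refine Ideal.span_le.mpr fun f hf => ?_
    obtain ⟨i, -, rfl⟩ := List.mem_map.mp hf
    simp [RingHom.mem_ker]

/-- An injective map identifies its codomain with its domain plus the complement of its range. -/
noncomputable def sumRangeComplEquiv {a μ : Type*} (f : a → μ) (hf : Function.Injective f) :
    μ ≃ a ⊕ ↥((Set.range f)ᶜ) :=
  open Classical in
  ((Equiv.ofInjective f hf).sumCongr (Equiv.refl _) |>.trans (Equiv.Set.sumCompl _)).symm

/-- Lower bounds on the heights of the ideals of minors of `A` bound from below the depth of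
the powers of the generic determinantal ideal along the evaluation at `A`. -/
theorem localDepthGE_of_height {K : Type*} [Field K] {d t m n : ℕ}
    (A : Matrix (Fin m) (Fin n) (MvPolynomial (Fin d) K))
    (hj : ∀ j : ℕ, 1 ≤ j → j ≤ t →
      (((m - j + 1) * (n - j + 1) : ℕ) : ℕ∞) ≤ idealHeight (minorsIdeal j A))
    {p : Ideal (MvPolynomial (Fin d) K)} [p.IsPrime] (hp : minorsIdeal t A ≤ p)
    {Q : Ideal (MvPolynomial (Fin m × Fin n) (MvPolynomial (Fin d) K))} [Q.IsPrime]
    (hQ : Q = p.comap (MvPolynomial.aeval fun ij : Fin m × Fin n => A ij.1 ij.2)) (k : ℕ) :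
    LocalDepthGE (minorsIdeal t (Matrix.of fun i j => MvPolynomial.X (i, j)) ^ k) Q (m * n) := by
  classical
  obtain ⟨j, hjp, hmin⟩ : ∃ j, minorsIdeal j A ≤ p ∧ ∀ i < j, ¬ minorsIdeal i A ≤ p :=
    have hex : ∃ j, minorsIdeal j A ≤ p := ⟨t, hp⟩
    ⟨Nat.find hex, Nat.find_spec hex, fun i hi => Nat.find_min hex hi⟩
  have hjt : j ≤ t := not_lt.mp fun hlt => hmin t hlt hp
  rcases j with _ | j
  · rw [minorsIdeal_zero, top_le_iff] at hjp
    exact absurd hjp Ideal.IsPrime.ne_top'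
  obtain ⟨f, g, hf, hg, hdet⟩ : ∃ (f : Fin j → Fin m) (g : Fin j → Fin n), Function.Injective f ∧
      Function.Injective g ∧ (A.submatrix f g).det ∉ p := by
    have := hmin j j.lt_succ_self
    rw [minorsIdeal, Ideal.span_le, Set.not_subset] at this
    obtain ⟨_, ⟨f, g, hf, hg, rfl⟩, h⟩ := this
    exact ⟨f, g, hf, hg, h⟩
  have hcompl : ∀ {N} (h : Fin j → Fin N), Function.Injective h →
      Nat.card ↥((Set.range h)ᶜ) = N - j := fun {N} h hh => by
    have := Nat.card_congr (sumRangeComplEquiv h hh)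
    rw [Nat.card_sum, Nat.card_fin, Nat.card_fin] at this
    omega
  have hle : ∀ N, N - j ≤ N - (j + 1) + 1 := fun N => by omega
  have hheight := le_height_of_le_idealHeight hjp (hj (j + 1) (by omega) hjt)
  have hdepth : PrimeDepthGE p (Nat.card (↥((Set.range f)ᶜ) × ↥((Set.range g)ᶜ))) := by
    refine primeDepthGE_mvPolynomial d p _ (le_trans ?_ hheight)
    rw [Nat.card_prod, hcompl f hf, hcompl g hg]
    exact_mod_cast Nat.mul_le_mul (hle m) (hle n)
  have := localDepthGE_minorsIdeal_pow (K := K) (sumRangeComplEquiv f hf)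
    (sumRangeComplEquiv g hg) A hdet hdepth hQ t k
  rwa [Nat.card_prod, Nat.card_fin, Nat.card_fin] at this

theorem minorsIdeal_pow_inf_ker_le {K : Type*} [Field K] {d t m n : ℕ}
    (A : Matrix (Fin m) (Fin n) (MvPolynomial (Fin d) K))
    (hj : ∀ j : ℕ, 1 ≤ j → j ≤ t →
      (((m - j + 1) * (n - j + 1) : ℕ) : ℕ∞) ≤ idealHeight (minorsIdeal j A)) {k : ℕ} :
    let J : Ideal (MvPolynomial (Fin m × Fin n) (MvPolynomial (Fin d) K)) :=
      minorsIdeal t (Matrix.of fun i j => MvPolynomial.X (i, j))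
    let N := RingHom.ker (MvPolynomial.aeval fun ij : Fin m × Fin n => A ij.1 ij.2 :
      _ →ₐ[MvPolynomial (Fin d) K] _).toRingHom
    J ^ k ⊓ N ≤ J ^ k * N := by
  intro J N
  let φ : MvPolynomial (Fin m × Fin n) (MvPolynomial (Fin d) K) →ₐ[_] _ :=
    MvPolynomial.aeval fun ij : Fin m × Fin n => A ij.1 ij.2
  have hNdef : N = RingHom.ker φ.toRingHom := rfl
  rw [hNdef, ker_aeval_eq_ofList]
  refine inf_ofList_le_mul _ _ fun Q _ hJQ hNQ => ?_
  rw [← ker_aeval_eq_ofList] at hNQ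
  have hQ : Q = (Q.comap MvPolynomial.C).comap φ := by
    ext f
    have : f - MvPolynomial.C (φ f) ∈ Q := hNQ (by simp [RingHom.mem_ker, φ])
    rw [Ideal.mem_comap, Ideal.mem_comap]
    exact ⟨fun h => (Submodule.sub_mem_iff_right _ h).mp this,
      fun h => (Submodule.sub_mem_iff_left _ h).mp this⟩
  have hp : minorsIdeal t A ≤ Q.comap MvPolynomial.C := by
    have hmap : J.map φ.toRingHom = minorsIdeal t A := by
      rw [minorsIdeal_map]
      congr 1
      ext1 i j
      simp [φ]
    rw [← hmap, Ideal.map_le_iff_le_comap]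
    exact (Ideal.IsPrime.le_of_pow_le hJQ).trans hQ.le
  have := localDepthGE_of_height A hj hp hQ k
  simpa using this

end

theorem statement_14 (K : Type*) [Field K] (d : ℕ) (hd : 0 < d)
    (t m n : ℕ) (h1t : 1 ≤ t) (htm : t < m) (hmn : m ≤ n)
    (A : Matrix (Fin m) (Fin n) (MvPolynomial (Fin d) K))
    (hgen : idealHeight (minorsIdeal t A) = (((m - t + 1) * (n - t + 1) : ℕ) : ℕ∞))
    (hj : ∀ j : ℕ, 1 ≤ j → j ≤ t - 1 →
      (((m - j + 1) * (n - j + 1) : ℕ) : ℕ∞) ≤ idealHeight (minorsIdeal j A)) :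
    ∀ k : ℕ, 0 < k →
      let R := MvPolynomial (Fin d) K
      let B := MvPolynomial (Fin m × Fin n) R
      let X : Matrix (Fin m) (Fin n) B := Matrix.of fun i j => MvPolynomial.X (i, j)
      let J : Ideal B := minorsIdeal t X
      let I : Ideal R := minorsIdeal t A
      letI : Algebra B R :=
        ((MvPolynomial.aeval fun p : Fin m × Fin n => A p.1 p.2 : B →ₐ[R] R)).toRingHom.toAlgebra
      letI : Module B B := Semiring.toModule
      let ψ : TensorProduct B (↥(J ^ k)) R →ₗ[B] R :=
        (TensorProduct.lid B R).toLinearMap.comp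
          (TensorProduct.map (Submodule.subtype (J ^ k)) LinearMap.id)
      Function.Injective ψ ∧ Set.range ψ = ((I ^ k : Ideal R) : Set R) := by
  intro k _ R B X J I ψ
  let : Algebra B R :=
    ((MvPolynomial.aeval fun p : Fin m × Fin n => A p.1 p.2 : B →ₐ[R] R)).toRingHom.toAlgebra
  have hheight : ∀ j : ℕ, 1 ≤ j → j ≤ t →
      (((m - j + 1) * (n - j + 1) : ℕ) : ℕ∞) ≤ idealHeight (minorsIdeal j A) := fun j h1 h2 => by
    rcases h2.lt_or_eq with h | rfl
    · exact hj j h1 (by omega)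
    · exact hgen.ge
  have hsurj : Function.Surjective (algebraMap B R) := fun r =>
    ⟨MvPolynomial.C r, MvPolynomial.aeval_C _ r⟩
  have hmap : J.map (algebraMap B R) = I := by
    rw [minorsIdeal_map]
    congr 1
    ext1 i j
    exact MvPolynomial.aeval_X _ _
  refine ⟨injective_lid_comp_map_subtype hsurj (J ^ k) (minorsIdeal_pow_inf_ker_le A hheight), ?_⟩
  rw [← hmap, ← Ideal.map_pow]
  exact range_lid_comp_map_subtype hsurj (J ^ k)
end

section
/- Let K be a field, R = K[x_1,…,x_d] a polynomial ring in d > 0 indeterminates, and m ≥ 1 an integer. Let A be an m×(m+1) matrix over R such that I = I_m(A) is of generic height (that is, ht I = 2), and suppose ht I_j(A) ≥ m−j+2 for all 1 ≤ j ≤ m−1 (i.e. I satisfies G_∞). Then I is of linear type. -/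
open Matrix

/-- The defining ideal of the Rees algebra of the ideal generated by the family `f`:
the kernel of the map `R[Tᵢ] → R[u]`, `Tᵢ ↦ fᵢ·u`. -/
noncomputable def reesDefIdeal {R : Type*} [CommRing R] {ι : Type*} (f : ι → R) :
    Ideal (MvPolynomial ι R) :=
  RingHom.ker (MvPolynomial.aeval fun i => Polynomial.C (f i) * Polynomial.X :
    MvPolynomial ι R →ₐ[R] Polynomial R)

/-- An ideal, presented by a generating family `f`, is of linear type if the defining ideal
of its Rees algebra is generated by elements homogeneous of degree `1` in the variables `Tᵢ`. -/
def IsLinearType {R : Type*} [CommRing R] {ι : Type*} (f : ι → R) : Prop :=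
  reesDefIdeal f = Ideal.span
    {p : MvPolynomial ι R | p ∈ reesDefIdeal f ∧ p.IsHomogeneous 1}

/-- An ideal of a `K`-algebra, presented by a generating family `f`, is of fiber type if the
defining ideal of its Rees algebra is generated by its elements homogeneous of degree `1` in
the variables `Tᵢ` together with its elements lying in the subring `K[Tᵢ]`. -/
def IsFiberType (K : Type*) [CommSemiring K] {R : Type*} [CommRing R] [Algebra K R]
    {ι : Type*} (f : ι → R) : Prop :=
  reesDefIdeal f = Ideal.span
    ({p : MvPolynomial ι R | p ∈ reesDefIdeal f ∧ p.IsHomogeneous 1} ∪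
     {p : MvPolynomial ι R | p ∈ reesDefIdeal f ∧
        ∃ q : MvPolynomial ι K, MvPolynomial.map (algebraMap K R) q = p})

universe u

open RingTheory.Sequence CategoryTheory Abelian in
/-- Dividing by a regular element lowers the range of vanishing `Ext` groups by at most one. -/
lemma subsingleton_ext_quotSMulTop {R : Type u} [CommRing R] (N M : ModuleCat.{u} R) {a : R}
    (ha : IsSMulRegular M a) {n : ℕ} (h : ∀ i < n + 1, Subsingleton (Ext N M i)) :
    ∀ i < n, Subsingleton (Ext N (ModuleCat.of R (QuotSMulTop a M)) i) := by
  intro i hi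
  have zero1 := AddCommGrpCat.isZero_of_iff_subsingleton.mpr (h i (by omega))
  have zero2 := AddCommGrpCat.isZero_of_iff_subsingleton.mpr (h (i + 1) (by omega))
  exact AddCommGrpCat.subsingleton_of_isZero <| ShortComplex.Exact.isZero_of_both_zeros
    ((Ext.covariant_sequence_exact₃' N ha.smulShortComplex_shortExact) i (i + 1) rfl)
    (zero1.eq_zero_of_src _) (zero2.eq_zero_of_tgt _)

open RingTheory.Sequence CategoryTheory Abelian in
lemma subsingleton_linearMap_quot_ofList {R : Type u} [CommRing R] (N M : ModuleCat.{u} R)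
    {rs : List R} (hrs : IsWeaklyRegular M rs)
    (h : ∀ i < rs.length + 1, Subsingleton (Ext N M i)) :
    Subsingleton (N →ₗ[R] (M ⧸ (Ideal.ofList rs • ⊤ : Submodule R M))) := by
  induction rs generalizing M with
  | nil =>
    have : Subsingleton (N ⟶ M) := Ext.addEquiv₀.subsingleton_congr.mp (h 0 (by simp))
    have : Subsingleton (N →ₗ[R] M) := ModuleCat.homAddEquiv.symm.subsingleton
    have e : (M ⧸ (Ideal.ofList ([] : List R) • ⊤ : Submodule R M)) ≃ₗ[R] M :=
      Submodule.quotEquivOfEqBot _ (by simp)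
    exact (LinearEquiv.congrRight (R := R) (M := N) e).toEquiv.subsingleton
  | cons a rs ih =>
    rw [isWeaklyRegular_cons_iff] at hrs
    have := ih (ModuleCat.of R (QuotSMulTop a M)) hrs.2
      (subsingleton_ext_quotSMulTop N M hrs.1 h)
    exact (LinearEquiv.congrRight (R := R) (M := N)
      (Submodule.quotOfListConsSMulTopEquivQuotSMulTopInner M a rs)).toEquiv.subsingleton

/-- Every prime ideal contains a weakly regular sequence of length equal to its height; for
Noetherian rings this is the Cohen–Macaulay property. -/
def HasHeightRegularSequences (R : Type*) [CommRing R] : Prop :=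
  ∀ P : Ideal R, P.IsPrime → ∃ rs : List R, (rs.length : ℕ∞) = P.height ∧ (∀ r ∈ rs, r ∈ P) ∧
    RingTheory.Sequence.IsWeaklyRegular R rs

open RingTheory.Sequence in
/-- Unmixedness: a prime killing a nonzero element modulo a weakly regular sequence has height at
most the length of the sequence. -/
lemma HasHeightRegularSequences.height_le {R : Type u} [CommRing R] [IsNoetherianRing R]
    (hR : HasHeightRegularSequences R) {rs : List R} (hrs : IsWeaklyRegular R rs)
    {P : Ideal R} (hP : P.IsPrime) {z : R} (hz : z ∉ Ideal.ofList rs)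
    (hPz : ∀ r ∈ P, r * z ∈ Ideal.ofList rs) : P.height ≤ rs.length := by
  by_contra! hlt
  obtain ⟨ss, hlen, hmem, hss⟩ := hR P hP
  have hlt' : rs.length < ss.length := by rw [← hlen] at hlt; exact_mod_cast hlt
  have hreg : IsRegular R ss := by
    refine ⟨hss, fun h => hP.ne_top ?_⟩
    rw [smul_eq_mul, Ideal.mul_top] at h
    exact top_le_iff.mp (h ▸ Ideal.span_le.mpr hmem)
  have hext := ModuleCat.subsingleton_ext_of_exists_isRegular P (ModuleCat.of R (R ⧸ P))
    (by simp [Module.support_eq_zeroLocus, Ideal.annihilator_quotient])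
    (ModuleCat.of R R) (by simpa [lt_top_iff_ne_top] using hP.ne_top) ss hmem hreg
  have := subsingleton_linearMap_quot_ofList (ModuleCat.of R (R ⧸ P)) (ModuleCat.of R R) hrs
    (fun i hi => hext i (by omega))
  let f : R →ₗ[R] (R ⧸ (Ideal.ofList rs • ⊤ : Submodule R R)) :=
    LinearMap.toSpanSingleton R _ (Submodule.Quotient.mk z)
  have hf : P ≤ LinearMap.ker f := by
    intro r hr
    simp only [f, LinearMap.mem_ker, LinearMap.toSpanSingleton_apply]
    rw [← Submodule.Quotient.mk_smul, Submodule.Quotient.mk_eq_zero]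
    simpa using hPz r hr
  have h0 : (Submodule.liftQ P f hf) = 0 := Subsingleton.elim (α := (R ⧸ P) →ₗ[R] _) _ _
  have h1 := congrArg (fun g => g (Submodule.Quotient.mk 1)) h0
  simp only [Submodule.liftQ_apply, f, LinearMap.toSpanSingleton_apply, one_smul,
    LinearMap.zero_apply, Submodule.Quotient.mk_eq_zero] at h1
  exact hz (by simpa using h1)

/-- An element outside an ideal of a Noetherian ring has its annihilator modulo the ideal inside an
associated prime. -/
lemma exists_isPrime_mul_mem_iff {R : Type*} [CommRing R] [IsNoetherianRing R] {I : Ideal R}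
    {z : R} (hz : z ∉ I) : ∃ P : Ideal R, P.IsPrime ∧ (∃ w ∉ I, ∀ r ∈ P, r * w ∈ I) ∧
      I ≤ P ∧ ∀ r, r * z ∈ I → r ∈ P := by
  obtain ⟨P, hP, hle⟩ := exists_le_isAssociatedPrime_of_isNoetherianRing R
    (Ideal.Quotient.mk I z) (by rwa [Ne, Ideal.Quotient.eq_zero_iff_mem])
  rw [isAssociatedPrime_iff] at hP
  obtain ⟨hprime, w, rfl⟩ := hP
  obtain ⟨w, rfl⟩ := Ideal.Quotient.mk_surjective w
  have key : ∀ r y : R, r • (Ideal.Quotient.mk I y) = 0 ↔ r * y ∈ I := by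
    intro r y
    rw [← Ideal.Quotient.eq_zero_iff_mem, map_mul]; rfl
  have key' : ∀ r y : R, r ∈ (⊥ : Submodule R (R ⧸ I)).colon {Ideal.Quotient.mk I y} ↔
      r * y ∈ I := by
    intro r y
    rw [Submodule.mem_colon_singleton, Submodule.mem_bot, key]
  refine ⟨_, hprime, ⟨w, fun hw => hprime.ne_top ?_, fun r hr => (key' r w).mp hr⟩, ?_, ?_⟩
  · rw [Ideal.eq_top_iff_one, key']; simpa
  · exact fun r hr => (key' r w).mpr (I.mul_mem_right _ hr)
  · exact fun r hr => hle ((key' r z).mpr hr)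

open RingTheory.Sequence in
lemma isSMulRegular_quot_ofList_iff {R : Type*} [CommRing R] (rs : List R) (a : R) :
    IsSMulRegular (R ⧸ (Ideal.ofList rs • ⊤ : Submodule R R)) a ↔
      ∀ z, a * z ∈ Ideal.ofList rs → z ∈ Ideal.ofList rs := by
  rw [isSMulRegular_iff_right_eq_zero_of_smul]
  constructor
  · intro h z hz
    have := h (Submodule.Quotient.mk z) (by
      rw [← Submodule.Quotient.mk_smul, Submodule.Quotient.mk_eq_zero]; simpa using hz)
    rw [Submodule.Quotient.mk_eq_zero] at this
    simpa using this
  · intro h z hz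
    obtain ⟨z, rfl⟩ := Submodule.Quotient.mk_surjective _ z
    rw [← Submodule.Quotient.mk_smul, Submodule.Quotient.mk_eq_zero] at hz
    rw [Submodule.Quotient.mk_eq_zero]
    simpa using h z (by simpa using hz)

open RingTheory.Sequence in
lemma isWeaklyRegular_concat_iff {R : Type*} [CommRing R] (rs : List R) (a : R) :
    IsWeaklyRegular R (rs ++ [a]) ↔ IsWeaklyRegular R rs ∧
      ∀ z, a * z ∈ Ideal.ofList rs → z ∈ Ideal.ofList rs := by
  rw [isWeaklyRegular_append_iff, isWeaklyRegular_singleton_iff, isSMulRegular_quot_ofList_iff]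

open RingTheory.Sequence in
/-- A sequence whose initial segments of length `i` generate ideals of height at least `i` is weakly
regular. -/
lemma HasHeightRegularSequences.isWeaklyRegular {R : Type u} [CommRing R] [IsNoetherianRing R]
    (hR : HasHeightRegularSequences R) (rs : List R)
    (h : ∀ i ≤ rs.length, ∀ P : Ideal R, P.IsPrime → (∀ r ∈ rs.take i, r ∈ P) → i ≤ P.height) :
    IsWeaklyRegular R rs := by
  induction rs using List.reverseRecOn with
  | nil => simp
  | append_singleton rs a ih =>
    have hrs : IsWeaklyRegular R rs := ih fun i hi P hP hmem => h i (by simp; omega) P hP (by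
      rwa [List.take_append_of_le_length hi])
    rw [isWeaklyRegular_concat_iff]
    refine ⟨hrs, fun z hz => ?_⟩
    by_contra hz'
    obtain ⟨P, hP, ⟨w, hw, hPw⟩, hle, hzP⟩ := exists_isPrime_mul_mem_iff hz'
    have h1 := hR.height_le hrs hP hw hPw
    have h2 := h (rs.length + 1) (by simp) P hP (by
      rw [List.take_of_length_le (by simp)]
      intro r hr
      rcases List.mem_append.mp hr with hr | hr
      · exact hle (Ideal.subset_span hr)
      · rw [List.mem_singleton.mp hr]; exact hzP a hz)
    have := h2.trans h1
    norm_cast at this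
    omega

open Polynomial in
lemma Polynomial.height_le_one_of_comap_C_eq_bot {D : Type*} [CommRing D] [IsDomain D]
    (Q : Ideal D[X]) [Q.IsPrime] (hQ : Q.comap C = ⊥) : Q.height ≤ 1 := by
  let := Polynomial.algebra D (FractionRing D)
  have := Polynomial.isLocalization (nonZeroDivisors D) (FractionRing D)
  have disj : Disjoint ((nonZeroDivisors D).map C : Set D[X]) Q := by
    refine Set.disjoint_left.mpr ?_
    rintro _ ⟨b, hb, rfl⟩ ha
    have : b ∈ Q.comap C := ha
    rw [hQ, Ideal.mem_bot] at this
    exact nonZeroDivisors.ne_zero hb this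
  rw [← IsLocalization.height_map_of_disjoint (S := (FractionRing D)[X])
    (Submonoid.map C (nonZeroDivisors D)) Q disj]
  have hp : (Q.map (algebraMap D[X] (FractionRing D)[X])).IsPrime :=
    IsLocalization.isPrime_of_isPrime_disjoint (Submonoid.map C (nonZeroDivisors D)) _ Q ‹_› disj
  have := Ideal.height_le_ringKrullDim_of_ne_top hp.ne_top
  rw [Polynomial.ringKrullDim_of_isNoetherianRing, ringKrullDim_eq_zero_of_field] at this
  exact_mod_cast this

open Polynomial in
lemma Polynomial.height_le_height_comap_C_add_one {R : Type*} [CommRing R] [IsNoetherianRing R]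
    (P : Ideal R[X]) [P.IsPrime] : P.height ≤ (P.comap C).height + 1 := by
  set p := P.comap C with hp
  have : P.LiesOver p := ⟨rfl⟩
  have : p.IsPrime := Ideal.comap_isPrime _ _
  rw [Ideal.height_eq_height_add_of_liesOver_of_hasGoingDown p P]
  gcongr
  let e : (R[X] ⧸ (p.map (algebraMap R R[X]))) ≃+* (R ⧸ p)[X] :=
    (Ideal.polynomialQuotientEquivQuotientPolynomial p).symm
  have : (P.map (Ideal.Quotient.mk <| p.map (algebraMap R R[X]))).IsPrime := by
    refine Ideal.map_isPrime_of_surjective Ideal.Quotient.mk_surjective ?_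
    rw [Ideal.mk_ker]
    exact Ideal.map_comap_le
  rw [← e.height_map]
  have := Ideal.map_isPrime_of_equiv e
    (I := (P.map (Ideal.Quotient.mk <| p.map (algebraMap R R[X]))))
  refine Polynomial.height_le_one_of_comap_C_eq_bot _ ?_
  rw [eq_bot_iff]
  intro x hx
  obtain ⟨r, rfl⟩ := Ideal.Quotient.mk_surjective x
  obtain ⟨y, hy, hyx⟩ := (Ideal.mem_map_of_equiv e _).mp (Ideal.mem_comap.mp hx)
  have he : e (Ideal.Quotient.mk _ (C r)) = C (Ideal.Quotient.mk p r) := by simp [e]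
  rw [← he, e.injective.eq_iff] at hyx
  have hpP : p.map (algebraMap R R[X]) ≤ P := Ideal.map_comap_le
  rw [hyx, Ideal.mem_quotient_iff_mem hpP] at hy
  rw [Ideal.mem_bot, Ideal.Quotient.eq_zero_iff_mem]
  exact hy

open Polynomial in
lemma Polynomial.exists_leadingCoeff_notMem {R : Type*} [CommRing R] {P : Ideal R[X]} {p : Ideal R}
    (hpP : p.map C ≤ P) (h : ¬ P ≤ p.map C) : ∃ g ∈ P, g.leadingCoeff ∉ p := by
  by_contra! hg
  refine h fun g hgP => ?_
  induction hn : g.support.card using Nat.strong_induction_on generalizing g with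
  | _ n ih =>
    by_cases h0 : g = 0
    · rw [h0]; exact zero_mem _
    · have hmon : monomial g.natDegree g.leadingCoeff ∈ p.map C := by
        rw [← C_mul_X_pow_eq_monomial]
        exact Ideal.mul_mem_right _ _ (Ideal.mem_map_of_mem _ (hg g hgP))
      have he : g.eraseLead ∈ P := by
        have := P.sub_mem hgP (hpP hmon)
        rwa [Polynomial.self_sub_monomial_natDegree_leadingCoeff] at this
      have := ih _ (hn ▸ eraseLead_support_card_lt h0) _ he rfl
      rw [← Polynomial.eraseLead_add_monomial_natDegree_leadingCoeff g]
      exact add_mem this hmon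

/-- In a Noetherian ring, an ideal consisting of zero divisors modulo `I` kills a nonzero element
modulo `I`. -/
lemma Ideal.exists_forall_mul_mem_of_forall_exists {R : Type*} [CommRing R] [IsNoetherianRing R]
    (I P : Ideal R) (h : ∀ a ∈ P, ∃ z ∉ I, a * z ∈ I) : ∃ z ∉ I, ∀ a ∈ P, a * z ∈ I := by
  by_contra! hz
  have : Subsingleton ((R ⧸ P) →ₗ[R] (R ⧸ I)) := by
    refine subsingleton_of_forall_eq 0 fun f => ?_
    obtain ⟨z, hfz⟩ := Ideal.Quotient.mk_surjective (f (Ideal.Quotient.mk P 1))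
    have hzI : z ∈ I := by
      by_contra hzI
      obtain ⟨a, ha, haz⟩ := hz z hzI
      apply haz
      rw [← Ideal.Quotient.eq_zero_iff_mem, map_mul, hfz]
      change a • f _ = 0
      rw [← map_smul]
      convert map_zero f
      change Ideal.Quotient.mk P (a • 1) = 0
      rw [Ideal.Quotient.eq_zero_iff_mem]; simpa using ha
    rw [Ideal.Quotient.eq_zero_iff_mem.mpr hzI] at hfz
    ext
    exact hfz.symm
  obtain ⟨a, ha, hreg⟩ := IsSMulRegular.subsingleton_linearMap_iff.mp this
  rw [Ideal.annihilator_quotient] at ha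
  obtain ⟨z, hz, haz⟩ := h a ha
  refine hz (Ideal.Quotient.eq_zero_iff_mem.mp (hreg.right_eq_zero_of_smul ?_))
  rw [← Ideal.Quotient.eq_zero_iff_mem, map_mul] at haz
  exact haz

open Polynomial RingTheory.Sequence in
lemma HasHeightRegularSequences.polynomial {R : Type u} [CommRing R] [IsNoetherianRing R]
    (hR : HasHeightRegularSequences R) : HasHeightRegularSequences R[X] := by
  intro P hP
  set p := P.comap C with hp
  have : P.LiesOver p := ⟨rfl⟩
  have hprime : p.IsPrime := Ideal.comap_isPrime _ _
  obtain ⟨rs, hlen, hmem, hrs⟩ := hR p hprime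
  have hrs' : IsWeaklyRegular R[X] (rs.map C) := hrs.of_flat
  have hmem' : ∀ r ∈ rs.map C, r ∈ P := by
    intro r hr
    obtain ⟨s, hs, rfl⟩ := List.mem_map.mp hr
    exact hmem s hs
  have hpP : p.map C ≤ P := Ideal.map_comap_le
  by_cases hle : P ≤ p.map C
  · refine ⟨rs.map C, ?_, hmem', hrs'⟩
    have hPp : P.map (Ideal.Quotient.mk (p.map (algebraMap R R[X]))) = ⊥ := by
      rw [Ideal.map_eq_bot_iff_le_ker, Ideal.mk_ker]
      exact hle
    have : (p.map (algebraMap R R[X])).IsPrime := by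
      have : p.map (algebraMap R R[X]) = P := le_antisymm hpP hle
      rwa [this]
    rw [Ideal.height_eq_height_add_of_liesOver_of_hasGoingDown p P, hPp, Ideal.height_bot,
      List.length_map, hlen, add_zero]
  · suffices h : ∃ a ∈ P, ∀ z, a * z ∈ Ideal.ofList (rs.map C) → z ∈ Ideal.ofList (rs.map C) by
      obtain ⟨a, ha, haz⟩ := h
      have hreg := (isWeaklyRegular_concat_iff _ _).mpr ⟨hrs', haz⟩
      have hmem_concat : ∀ r ∈ rs.map C ++ [a], r ∈ P := by
        intro r hr
        rcases List.mem_append.mp hr with hr | hr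
        · exact hmem' r hr
        · rwa [List.mem_singleton.mp hr]
      have hup := Polynomial.height_le_height_comap_C_add_one P
      have hlt : p.height + 1 ≤ P.height := by
        rw [Ideal.height_eq_height_add_of_liesOver_of_hasGoingDown p P]
        gcongr
        rw [Order.one_le_iff_ne_zero]
        have : (p.map (algebraMap R R[X])).IsPrime := Ideal.isPrime_map_C_of_isPrime
        rw [Ne, Ideal.height_eq_zero_iff_eq_bot, Ideal.map_eq_bot_iff_le_ker, Ideal.mk_ker]
        exact hle
      refine ⟨rs.map C ++ [a], ?_, hmem_concat, hreg⟩
      rw [le_antisymm hup hlt, ← hlen]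
      simp
    by_contra! hcon
    obtain ⟨h, hh, hPh⟩ := Ideal.exists_forall_mul_mem_of_forall_exists (Ideal.ofList (rs.map C)) P
      (fun a ha => let ⟨z, h1, h2⟩ := hcon a ha; ⟨z, h2, h1⟩)
    obtain ⟨g, hg, hgp⟩ := Polynomial.exists_leadingCoeff_notMem hpP hle
    rw [← Ideal.map_ofList] at hh hPh
    set I := Ideal.ofList rs with hI
    have key : ∀ f : R[X], f ∈ I.map C ↔ f.map (Ideal.Quotient.mk I) = 0 := by
      intro f
      rw [Ideal.mem_map_C_iff, Polynomial.ext_iff]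
      simp [Ideal.Quotient.eq_zero_iff_mem]
    have hh0 : h.map (Ideal.Quotient.mk I) ≠ 0 := fun h0 => hh ((key h).mpr h0)
    obtain ⟨w, hw⟩ := Ideal.Quotient.mk_surjective (h.map (Ideal.Quotient.mk I)).leadingCoeff
    have hwI : w ∉ I := by
      rw [← Ideal.Quotient.eq_zero_iff_mem, hw]
      simpa using hh0
    obtain ⟨q, hq, ⟨v, hv, hqv⟩, hIq, hqw⟩ := exists_isPrime_mul_mem_iff hwI
    have hmul : ∀ f ∈ P, f.leadingCoeff ∈ q := by
      intro f hf
      by_cases hfI : f.leadingCoeff ∈ I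
      · exact hIq hfI
      · apply hqw
        have := (key _).mp (hPh f hf)
        rw [Polynomial.map_mul] at this
        have h2 := congrArg (fun k => coeff k
          ((f.map (Ideal.Quotient.mk I)).natDegree + (h.map (Ideal.Quotient.mk I)).natDegree)) this
        simp only [coeff_mul_degree_add_degree, coeff_zero] at h2
        rw [← Ideal.Quotient.eq_zero_iff_mem, map_mul, hw]
        rwa [leadingCoeff_map_of_leadingCoeff_ne_zero] at h2
        rwa [Ne, Ideal.Quotient.eq_zero_iff_mem]
    have hpq : p ≤ q := fun r hr => by simpa using hmul (C r) hr
    have hlt : p < q := lt_of_le_of_ne hpq fun h => hgp (h ▸ hmul g hg)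
    have h1 := hR.height_le hrs hq hv hqv
    have h2 := Ideal.height_strict_mono_of_isPrime_of_isPrime hlt
    rw [← hlen] at h2
    exact absurd h2 (not_lt.mpr h1)

open RingTheory.Sequence in
lemma HasHeightRegularSequences.of_ringEquiv {R S : Type*} [CommRing R] [CommRing S]
    (e : R ≃+* S) (hR : HasHeightRegularSequences R) : HasHeightRegularSequences S := by
  intro P hP
  obtain ⟨rs, hlen, hmem, hrs⟩ := hR (P.comap e) (Ideal.comap_isPrime _ _)
  let _ := e.toRingHom.toAlgebra
  have : Module.Flat R S := Module.Flat.of_linearEquiv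
    ({ e with map_smul' := fun r x => by simp [Algebra.smul_def]; rfl } : R ≃ₗ[R] S).symm
  refine ⟨rs.map (algebraMap R S), ?_, ?_, hrs.of_flat⟩
  · rw [List.length_map, hlen, e.height_comap]
  · intro r hr
    obtain ⟨s, hs, rfl⟩ := List.mem_map.mp hr
    exact hmem s hs

lemma HasHeightRegularSequences.mvPolynomial {R : Type u} [CommRing R] [IsNoetherianRing R]
    (hR : HasHeightRegularSequences R) (ι : Type*) [Finite ι] :
    HasHeightRegularSequences (MvPolynomial ι R) := by
  induction ι using Finite.induction_empty_option with
  | of_equiv e h => exact h.of_ringEquiv (MvPolynomial.renameEquiv R e).toRingEquiv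
  | h_empty => exact hR.of_ringEquiv (MvPolynomial.isEmptyAlgEquiv R PEmpty).symm.toRingEquiv
  | h_option h =>
    exact h.polynomial.of_ringEquiv (MvPolynomial.optionEquivLeft R _).symm.toRingEquiv

lemma Field.hasHeightRegularSequences (K : Type*) [Field K] : HasHeightRegularSequences K := by
  intro P hP
  refine ⟨[], ?_, by simp, by simp⟩
  rw [(Ideal.eq_bot_or_top P).resolve_right hP.ne_top, Ideal.height_bot]
  rfl

namespace MvPolynomial

lemma isPrime_span_X_image {σ D : Type*} [CommRing D] [IsDomain D] (s : Set σ) :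
    (Ideal.span (X '' s : Set (MvPolynomial σ D))).IsPrime := by
  classical
  let φ : MvPolynomial σ D →ₐ[D] MvPolynomial σ D := aeval fun i => if i ∈ s then 0 else X i
  have hφ : Ideal.span (X '' s : Set (MvPolynomial σ D)) = RingHom.ker φ := by
    apply le_antisymm
    · rw [Ideal.span_le]
      rintro _ ⟨i, hi, rfl⟩
      simp [φ, hi]
    · intro f hf
      have hcomp : (Ideal.Quotient.mkₐ D (Ideal.span (X '' s : Set (MvPolynomial σ D)))).comp φ =
          Ideal.Quotient.mkₐ D _ := by
        ext i
        by_cases hi : i ∈ s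
        · simpa [φ, hi] using (Ideal.Quotient.eq_zero_iff_mem.mpr
            (Ideal.subset_span (Set.mem_image_of_mem X hi))).symm
        · simp [φ, hi]
      have := DFunLike.congr_fun hcomp f
      rw [AlgHom.comp_apply, (RingHom.mem_ker).mp hf, map_zero] at this
      exact Ideal.Quotient.eq_zero_iff_mem.mp this.symm
  rw [hφ]
  exact RingHom.ker_isPrime _

lemma card_le_height_of_X_mem {σ D : Type*} [CommRing D] [IsDomain D] (s : Finset σ)
    (Q : Ideal (MvPolynomial σ D)) (hQ : ∀ i ∈ s, X i ∈ Q) : (s.card : ℕ∞) ≤ Q.height := by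
  classical
  suffices h : (s.card : ℕ∞) ≤ (Ideal.span (X '' (s : Set σ) : Set (MvPolynomial σ D))).height by
    refine h.trans (Ideal.height_mono (Ideal.span_le.mpr ?_))
    rintro _ ⟨i, hi, rfl⟩
    exact hQ i hi
  clear hQ Q
  induction s using Finset.induction_on with
  | empty => simp
  | insert a s ha ih =>
    have h1 := isPrime_span_X_image (D := D) (s : Set σ)
    have h2 := isPrime_span_X_image (D := D) ((insert a s : Finset σ) : Set σ)
    have hlt : Ideal.span (X '' (s : Set σ) : Set (MvPolynomial σ D)) <
        Ideal.span (X '' ((insert a s : Finset σ) : Set σ)) := by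
      refine lt_of_le_of_ne (Ideal.span_mono (Set.image_mono (by simp))) fun h => ?_
      have hmem : (X a : MvPolynomial σ D) ∈ Ideal.span (X '' (s : Set σ)) := by
        rw [h]; exact Ideal.subset_span ⟨a, by simp, rfl⟩
      rw [mem_ideal_span_X_image] at hmem
      obtain ⟨i, hi, hne⟩ := hmem (Finsupp.single a 1) (by simp [support_X])
      rw [Finsupp.single_apply_ne_zero] at hne
      exact ha (hne.1 ▸ hi)
    rw [Finset.card_insert_of_notMem ha]
    rw [Nat.cast_add, Nat.cast_one]
    exact (add_le_add_left ih 1).trans (Ideal.height_add_one_le_of_lt_of_isPrime hlt)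

/-- The linear form with a given coefficient vector. -/
noncomputable def linearForm {ι R : Type*} [Fintype ι] [CommRing R] (v : ι → R) :
    MvPolynomial ι R :=
  ∑ i, C (v i) * X i

lemma card_le_height_of_linearForm_mem_of_field {κ ι α : Type*} [Field κ] [Fintype ι] [Fintype α]
    {v : α → ι → κ} (hv : LinearIndependent κ v) (Q : Ideal (MvPolynomial ι κ))
    (hQ : ∀ a, linearForm (v a) ∈ Q) : (Fintype.card α : ℕ∞) ≤ Q.height := by
  classical
  let b := Module.Basis.sumExtend hv
  let e := (SymmetricAlgebra.equivMvPolynomial (Pi.basisFun κ ι)).symm.trans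
    (SymmetricAlgebra.equivMvPolynomial b)
  have he : ∀ a, e (linearForm (v a)) = X (Sum.inl a) := by
    intro a
    have hb : b (Sum.inl a) = v a := by simp [b, Module.Basis.sumExtend]; rfl
    have h1 : (SymmetricAlgebra.equivMvPolynomial (Pi.basisFun κ ι)).symm (linearForm (v a)) =
        SymmetricAlgebra.ι κ (ι → κ) (v a) := by
      simp only [linearForm, map_sum, map_mul, SymmetricAlgebra.equivMvPolynomial_symm_X]
      conv_rhs => rw [← (Pi.basisFun κ ι).sum_repr (v a)]
      simp only [map_sum, map_smul]
      refine Finset.sum_congr rfl fun i _ => ?_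
      rw [Algebra.smul_def, ← MvPolynomial.algebraMap_eq, AlgEquiv.commutes, Pi.basisFun_repr]
    simp only [e, AlgEquiv.trans_apply, h1]
    rw [← hb, SymmetricAlgebra.equivMvPolynomial_ι_apply]
  have h := card_le_height_of_X_mem (Finset.univ.map Function.Embedding.inl)
    (Q.map e.toRingEquiv) (by
      intro i hi
      obtain ⟨a, -, rfl⟩ := Finset.mem_map.mp hi
      have := Ideal.mem_map_of_mem e.toRingEquiv (hQ a)
      rw [show e.toRingEquiv (linearForm (v a)) = X (Sum.inl a) from he a] at this
      exact this)
  rw [RingEquiv.height_map] at h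
  simpa using h

lemma map_linearForm {ι R S : Type*} [Fintype ι] [CommRing R] [CommRing S] (f : R →+* S)
    (v : ι → R) : map f (linearForm v) = linearForm (fun i => f (v i)) := by
  simp [linearForm]

lemma height_add_card_le_height {R ι α : Type*} [CommRing R] [IsNoetherianRing R] [Fintype ι]
    [Fintype α] (P : Ideal (MvPolynomial ι R)) [P.IsPrime] (p : Ideal R) [p.IsPrime]
    (hp : P.comap C = p) {v : α → ι → R}
    (hv : LinearIndependent (FractionRing (R ⧸ p))
      fun a i => algebraMap (R ⧸ p) (FractionRing (R ⧸ p)) (Ideal.Quotient.mk p (v a i)))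
    (hP : ∀ a, linearForm (v a) ∈ P) : p.height + Fintype.card α ≤ P.height := by
  have : P.LiesOver p := ⟨hp.symm⟩
  have hpP : p.map (algebraMap R (MvPolynomial ι R)) ≤ P := Ideal.map_le_iff_le_comap.mpr hp.ge
  rw [Ideal.height_eq_height_add_of_liesOver_of_hasGoingDown p P]
  gcongr
  let e : (MvPolynomial ι R ⧸ (p.map (algebraMap R (MvPolynomial ι R)))) ≃+*
      MvPolynomial ι (R ⧸ p) := (quotientEquivQuotientMvPolynomial p).symm.toRingEquiv
  have he : ∀ f, e (Ideal.Quotient.mk _ f) = map (Ideal.Quotient.mk p) f := by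
    intro f
    change bind₂ (C.comp (Ideal.Quotient.mk p)) f = _
    rw [← bind₂_map, bind₂_C_left, RingHom.id_apply]
  have : (P.map (Ideal.Quotient.mk (p.map (algebraMap R (MvPolynomial ι R))))).IsPrime := by
    refine Ideal.map_isPrime_of_surjective Ideal.Quotient.mk_surjective ?_
    rwa [Ideal.mk_ker]
  rw [← e.height_map]
  set Q := (P.map (Ideal.Quotient.mk (p.map (algebraMap R (MvPolynomial ι R))))).map e with hQ
  have hQprime : Q.IsPrime := Ideal.map_isPrime_of_equiv e
  have hQmem : ∀ f ∈ P, map (Ideal.Quotient.mk p) f ∈ Q := fun f hf => by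
    rw [← he]; exact Ideal.mem_map_of_mem _ (Ideal.mem_map_of_mem _ hf)
  have disj : Disjoint (((nonZeroDivisors (R ⧸ p)).map C : Submonoid (MvPolynomial ι (R ⧸ p))) :
      Set (MvPolynomial ι (R ⧸ p))) Q := by
    refine Set.disjoint_left.mpr ?_
    rintro _ ⟨b, hb, rfl⟩ ha
    obtain ⟨r, rfl⟩ := Ideal.Quotient.mk_surjective b
    obtain ⟨y, hy, hyx⟩ := (Ideal.mem_map_of_equiv e _).mp ha
    have := he (C r)
    rw [map_C, ← hyx, e.injective.eq_iff] at this
    rw [← this, Ideal.mem_quotient_iff_mem hpP] at hy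
    refine nonZeroDivisors.ne_zero hb (Ideal.Quotient.eq_zero_iff_mem.mpr ?_)
    rw [← hp]; exact hy
  let := algebraMvPolynomial (R := R ⧸ p) (S := FractionRing (R ⧸ p)) (σ := ι)
  rw [← IsLocalization.height_map_of_disjoint (S := MvPolynomial ι (FractionRing (R ⧸ p)))
    (Submonoid.map C (nonZeroDivisors (R ⧸ p))) Q disj]
  refine card_le_height_of_linearForm_mem_of_field hv _ fun a => ?_
  have := Ideal.mem_map_of_mem (algebraMap (MvPolynomial ι (R ⧸ p))
    (MvPolynomial ι (FractionRing (R ⧸ p)))) (hQmem _ (hP a))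
  rwa [map_linearForm, algebraMap_def, map_linearForm] at this

end MvPolynomial

namespace MvPolynomial

lemma isHomogeneous_linearForm {ι R : Type*} [Fintype ι] [CommRing R] (v : ι → R) :
    (linearForm v).IsHomogeneous 1 :=
  IsHomogeneous.sum _ _ _ fun i _ => isHomogeneous_C_mul_X (v i) i

lemma IsHomogeneous.aeval_mul_right {ι R A : Type*} [CommRing R] [CommRing A] [Algebra R A]
    {G : MvPolynomial ι R} {n : ℕ} (hG : G.IsHomogeneous n) (x : ι → A) (a : A) :
    MvPolynomial.aeval (fun i => x i * a) G = a ^ n * MvPolynomial.aeval x G := by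
  simp only [aeval_def, eval₂_eq, Finset.mul_sum]
  refine Finset.sum_congr rfl fun e he => ?_
  have hdeg : e.degree = n := by
    rw [Finsupp.degree_eq_weight_one]
    exact hG (mem_support_iff.mp he)
  simp only [mul_pow, Finset.prod_mul_distrib, Finset.prod_pow_eq_pow_sum]
  rw [← hdeg, Finsupp.degree_apply]
  ring

end MvPolynomial

section ReesAlgebra

open MvPolynomial

lemma linearForm_mem_reesDefIdeal_iff {ι R : Type*} [Fintype ι] [CommRing R] (f v : ι → R) :
    linearForm v ∈ reesDefIdeal f ↔ ∑ i, v i * f i = 0 := by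
  have : (MvPolynomial.aeval fun i => Polynomial.C (f i) * Polynomial.X :
      MvPolynomial ι R →ₐ[R] Polynomial R) (linearForm v) =
      Polynomial.C (∑ i, v i * f i) * Polynomial.X := by
    simp [linearForm, Finset.sum_mul, Polynomial.algebraMap_eq, mul_assoc]
  rw [reesDefIdeal, RingHom.mem_ker, this]
  refine ⟨fun h => ?_, fun h => by rw [h]; simp⟩
  simpa using congrArg (Polynomial.coeff · 1) h

lemma eval_eq_zero_of_mem_reesDefIdeal {ι R : Type*} [CommRing R] {f : ι → R}
    {g : MvPolynomial ι R} (hg : g ∈ reesDefIdeal f) (n : ℕ) :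
    eval f (homogeneousComponent n g) = 0 := by
  have key : ∀ k, (MvPolynomial.aeval fun i => Polynomial.C (f i) * Polynomial.X :
      MvPolynomial ι R →ₐ[R] Polynomial R) (homogeneousComponent k g) =
      Polynomial.X ^ k * Polynomial.C (eval f (homogeneousComponent k g)) := by
    intro k
    rw [(homogeneousComponent_isHomogeneous k g).aeval_mul_right]
    congr 1
    exact aeval_algebraMap_apply (Polynomial R) f _
  by_cases hn : n ≤ g.totalDegree
  · have h0 := RingHom.mem_ker.mp hg
    rw [← sum_homogeneousComponent g, map_sum] at h0
    have := congrArg (Polynomial.coeff · n) h0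
    simpa [key, Polynomial.finsetSum_coeff, Polynomial.coeff_X_pow_mul', Polynomial.coeff_C,
      Nat.lt_succ_iff, hn] using this
  · rw [homogeneousComponent_eq_zero _ _ (not_le.mp hn), map_zero]

/-- If every variable is, up to a nonzero factor `D`, proportional to a fixed variable modulo
relations, then the ideal of the Rees algebra is generated by these relations after inverting
`D`. -/
lemma exists_pow_mul_mem_of_mem_reesDefIdeal {ι R : Type*} [Fintype ι] [CommRing R] [IsDomain R]
    {f : ι → R} (hf : f ≠ 0) {J : Ideal (MvPolynomial ι R)} (hJ : J ≤ reesDefIdeal f) {D : R}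
    (hD : D ≠ 0) (k : ι) (c : ι → R) (hc : ∀ i, C D * X i - C (c i) * X k ∈ J)
    {g : MvPolynomial ι R} (hg : g ∈ reesDefIdeal f) : ∃ N, C (D ^ N) * g ∈ J := by
  have hcf : ∀ i, D * f i = c i * f k := by
    intro i
    have := RingHom.mem_ker.mp (hJ (hc i))
    have := congrArg (Polynomial.coeff · 1) this
    simpa [Polynomial.algebraMap_eq, sub_eq_zero] using this
  have hfk : f k ≠ 0 := fun h => hf (funext fun i => by
    simpa [h, hD] using hcf i)
  have hom : ∀ n, C (D ^ n) * homogeneousComponent n g ∈ J := by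
    intro n
    set G := homogeneousComponent n g
    have hG : G.IsHomogeneous n := homogeneousComponent_isHomogeneous n g
    have hcG : eval c G = 0 := by
      have h1 := hG.aeval_mul_right f D
      have h2 := hG.aeval_mul_right c (f k)
      simp only [← hcf, mul_comm D] at h2
      rw [h1, aeval_eq_eval, aeval_eq_eval,
        eval_eq_zero_of_mem_reesDefIdeal hg, mul_zero] at h2
      simpa [hfk] using h2.symm
    have h1 := hG.aeval_mul_right (A := MvPolynomial ι R) X (C D)
    have h2 := hG.aeval_mul_right (A := MvPolynomial ι R) (fun i => C (c i)) (X k)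
    have h3 : aeval (fun i => C (c i) : ι → MvPolynomial ι R) G = C (eval c G) :=
      aeval_algebraMap_apply (MvPolynomial ι R) c G
    rw [h3, hcG, map_zero, mul_zero] at h2
    rw [aeval_X_left_apply] at h1
    rw [map_pow, ← h1, ← Ideal.Quotient.eq_zero_iff_mem]
    rw [← Ideal.Quotient.mkₐ_eq_mk R, ← AlgHom.comp_apply, comp_aeval]
    rw [← map_zero (Ideal.Quotient.mkₐ R J), ← h2, ← AlgHom.comp_apply, comp_aeval]
    congr 2
    funext i
    simp only [Ideal.Quotient.mkₐ_eq_mk]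
    rw [Ideal.Quotient.eq, mul_comm]
    exact hc i
  refine ⟨g.totalDegree, ?_⟩
  nth_rw 2 [← sum_homogeneousComponent g]
  rw [Finset.mul_sum]
  refine sum_mem fun n hn => ?_
  rw [← Nat.sub_add_cancel (Nat.lt_succ_iff.mp (Finset.mem_range.mp hn)), pow_add, map_mul,
    mul_assoc]
  exact J.mul_mem_left _ (hom n)

lemma Matrix.linearIndependent_of_det_submatrix_notMem {R α ι τ : Type*} [CommRing R] [Fintype τ]
    [DecidableEq τ] (B : Matrix α ι R) (p : Ideal R) [p.IsPrime] (r : τ → α) (c : τ → ι)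
    (h : (B.submatrix r c).det ∉ p) :
    LinearIndependent (FractionRing (R ⧸ p)) fun a i =>
      algebraMap (R ⧸ p) (FractionRing (R ⧸ p)) (Ideal.Quotient.mk p (B (r a) i)) := by
  let φ := (algebraMap (R ⧸ p) (FractionRing (R ⧸ p))).comp (Ideal.Quotient.mk p)
  have hdet : ((B.submatrix r c).map φ).det ≠ 0 := by
    rw [← RingHom.mapMatrix_apply, ← RingHom.map_det, RingHom.comp_apply, Ne,
      FaithfulSMul.algebraMap_eq_zero_iff, Ideal.Quotient.eq_zero_iff_mem]
    exact h
  exact LinearIndependent.of_comp (LinearMap.funLeft _ _ c)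
    (Matrix.linearIndependent_rows_of_det_ne_zero hdet)

/-- The height of a prime containing the first `k` linear forms attached to the rows of a matrix
with a minor of size `t` outside the contraction of the prime. -/
lemma height_add_le_of_linearForm_mem {R ι : Type*} [CommRing R] [IsNoetherianRing R] [Fintype ι]
    {m t k : ℕ} (hk : k ≤ m) (B : Matrix (Fin m) ι R) (P : Ideal (MvPolynomial ι R)) [P.IsPrime]
    (hP : ∀ i : Fin m, i.val < k → linearForm (B i) ∈ P) (r : Fin t → Fin m) (c : Fin t → ι)
    (hr : Function.Injective r) (h : (B.submatrix r c).det ∉ P.comap C) :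
    (P.comap C).height + t + k ≤ P.height + m := by
  have : (P.comap (C : R →+* MvPolynomial ι R)).IsPrime := Ideal.comap_isPrime _ _
  have hli := (B.linearIndependent_of_det_submatrix_notMem _ r c h).comp
    (Subtype.val : {a : Fin t // (r a).val < k} → Fin t) Subtype.val_injective
  have hle := height_add_card_le_height P _ rfl (v := fun a : {a // (r a).val < k} => B (r a))
    hli fun a => hP _ a.2
  have hcard : t + k ≤ Fintype.card {a : Fin t // (r a).val < k} + m := by
    have h1 := Fintype.card_subtype_compl fun a : Fin t => (r a).val < k
    have h2 : Fintype.card {a : Fin t // ¬ (r a).val < k} ≤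
        Fintype.card {i : Fin m // ¬ i.val < k} :=
      Fintype.card_le_of_injective (fun a => ⟨r a, a.2⟩) fun a b hab =>
        Subtype.ext (hr (congrArg Subtype.val hab))
    have h3 := Fintype.card_subtype_compl fun i : Fin m => i.val < k
    have h4 : Fintype.card {i : Fin m // i.val < k} = k := by
      rw [Fintype.card_subtype, Fin.card_filter_val_lt, min_eq_right hk]
    have h5 := Fintype.card_subtype_le fun a : Fin t => (r a).val < k
    simp only [Fintype.card_fin] at *
    omega
  calc (P.comap C).height + t + k = (P.comap C).height + ((t + k : ℕ) : ℕ∞) := by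
        rw [Nat.cast_add, add_assoc]
    _ ≤ (P.comap C).height + ((Fintype.card {a : Fin t // (r a).val < k} + m : ℕ) : ℕ∞) := by
        gcongr
    _ ≤ P.height + m := by
        rw [Nat.cast_add, ← add_assoc]
        gcongr

/-- Cramer's rule: modulo the linear forms attached to the rows of an `m × (m + 1)` matrix, all
variables are proportional to a fixed one up to a maximal minor. -/
lemma exists_det_mul_X_sub_mem {R ι : Type*} [CommRing R] [Fintype ι]
    {m : ℕ} (hι : Fintype.card ι = m + 1) (B : Matrix (Fin m) ι R) (J : Ideal (MvPolynomial ι R))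
    (hJ : ∀ i, linearForm (B i) ∈ J) (r : Fin m → Fin m) (c : Fin m → ι)
    (hc : Function.Injective c) : ∃ (k : ι) (w : ι → R), ∀ i,
      C (B.submatrix r c).det * X i - C (w i) * X k ∈ J := by
  classical
  set M := B.submatrix r c with hM
  obtain ⟨k, hk⟩ : ∃ k, (Finset.univ.image c)ᶜ = {k} := by
    rw [← Finset.card_eq_one, Finset.card_compl, Finset.card_image_of_injective _ hc, hι]
    simp
  have hkc : ∀ i, i ≠ k → ∃ a, c a = i := by
    intro i hi
    by_contra! hne
    have : i ∈ (Finset.univ.image c)ᶜ := by simpa using hne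
    rw [hk, Finset.mem_singleton] at this
    exact hi this
  refine ⟨k, ?_⟩
  suffices h : ∀ i, ∃ w, C M.det * X i - C w * X k ∈ J by choose w hw using h; exact ⟨w, hw⟩
  intro i
  by_cases hi : i = k
  · exact ⟨M.det, by rw [hi, sub_self]; exact zero_mem _⟩
  · obtain ⟨a, rfl⟩ := hkc i hi
    refine ⟨-∑ b, M.adjugate a b * B (r b) k, ?_⟩
    have hmem : ∑ b, C (M.adjugate a b) * linearForm (B (r b)) ∈ J :=
      sum_mem fun b _ => J.mul_mem_left _ (hJ _)
    convert hmem using 1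
    have hsum : ∑ b, C (M.adjugate a b) * linearForm (B (r b)) =
        ∑ q, C (∑ b, M.adjugate a b * B (r b) q) * X q := by
      simp only [linearForm, Finset.mul_sum, map_sum, Finset.sum_mul, map_mul, mul_assoc]
      exact Finset.sum_comm
    have hadj : ∀ a', ∑ b, M.adjugate a b * B (r b) (c a') = if a = a' then M.det else 0 := by
      intro a'
      have := congrFun (congrFun M.adjugate_mul a) a'
      rwa [Matrix.mul_apply, Matrix.smul_apply, Matrix.one_apply, smul_eq_mul, mul_ite, mul_one,
        mul_zero] at this
    rw [hsum, ← Finset.sum_add_sum_compl (Finset.univ.image c), hk, Finset.sum_singleton,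
      Finset.sum_image hc.injOn]
    simp [hadj, apply_ite]

/-- A Hilbert–Burch type ideal whose presentation matrix has minors of the expected heights is of
linear type. -/
lemma isLinearType_of_exists_minor_notMem {R ι : Type*} [CommRing R] [IsDomain R]
    [IsNoetherianRing R] [Fintype ι] {m : ℕ} (hι : Fintype.card ι = m + 1)
    (hS : HasHeightRegularSequences (MvPolynomial ι R)) (B : Matrix (Fin m) ι R) {f : ι → R}
    (hf : f ≠ 0) (hBf : ∀ i, ∑ q, B i q * f q = 0)
    (hB : ∀ p : Ideal R, p.IsPrime → ∃ (t : ℕ) (r : Fin t → Fin m) (c : Fin t → ι),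
      Function.Injective r ∧ Function.Injective c ∧ (B.submatrix r c).det ∉ p ∧
      (t = m ∨ (m + 1 : ℕ∞) ≤ p.height + t)) : IsLinearType f := by
  set ℓ : List (MvPolynomial ι R) := List.ofFn fun i => linearForm (B i) with hℓ
  have hlen : ℓ.length = m := List.length_ofFn
  have hmemJ : ∀ i, linearForm (B i) ∈ Ideal.ofList ℓ := fun i =>
    Ideal.subset_span (List.mem_ofFn.mpr ⟨i, rfl⟩)
  have hJ : Ideal.ofList ℓ ≤ reesDefIdeal f := by
    refine Ideal.span_le.mpr fun x hx => ?_
    obtain ⟨i, rfl⟩ := List.mem_ofFn.mp hx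
    exact (linearForm_mem_reesDefIdeal_iff f _).mpr (hBf i)
  have hreg : RingTheory.Sequence.IsWeaklyRegular (MvPolynomial ι R) ℓ := by
    refine hS.isWeaklyRegular ℓ fun k hk P hP hmem => ?_
    obtain ⟨t, r, c, hr, -, hdet, ht⟩ := hB (P.comap C) (Ideal.comap_isPrime _ _)
    have h1 := height_add_le_of_linearForm_mem (hlen ▸ hk) B P (fun i hi => hmem _ (by
      rw [List.mem_take_iff_getElem]
      exact ⟨i, by simp [hlen, hi], by simp [hℓ]⟩)) r c hr hdet
    have h2 : (m : ℕ∞) ≤ (P.comap C).height + t := by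
      rcases ht with rfl | ht
      · exact le_add_self
      · exact le_self_add.trans ht
    have h3 : (m : ℕ∞) + k ≤ m + P.height := by
      rw [add_comm _ P.height]
      exact le_trans (by gcongr) h1
    exact (ENat.add_le_add_iff_left (ENat.natCast_ne_top m)).mp h3
  have hle : reesDefIdeal f ≤ Ideal.ofList ℓ := by
    intro g hg
    by_contra hgJ
    obtain ⟨P, hP, ⟨w, hw, hPw⟩, hJP, hgP⟩ := exists_isPrime_mul_mem_iff hgJ
    have hht := hS.height_le hreg hP hw hPw
    rw [hlen] at hht
    obtain ⟨t, r, c, hr, hc, hdet, ht⟩ := hB (P.comap C) (Ideal.comap_isPrime _ _)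
    rcases ht with rfl | ht
    · obtain ⟨k, w, hkw⟩ := exists_det_mul_X_sub_mem hι B _ hmemJ r c hc
      have hD : (B.submatrix r c).det ≠ 0 := fun h => hdet (h ▸ zero_mem _)
      obtain ⟨N, hN⟩ := exists_pow_mul_mem_of_mem_reesDefIdeal hf hJ hD k w hkw hg
      exact hdet (hP.mem_of_pow_mem N (by rw [← map_pow]; exact hgP _ hN))
    · have h1 := height_add_le_of_linearForm_mem le_rfl B P (fun i _ => hJP (hmemJ i)) r c hr hdet
      have h2 := (ENat.add_le_add_iff_right (ENat.natCast_ne_top m)).mp h1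
      have h3 := ht.trans (h2.trans hht)
      norm_cast at h3
      omega
  refine le_antisymm (hle.trans (Ideal.span_le.mpr fun x hx => ?_))
    (Ideal.span_le.mpr fun x hx => hx.1)
  obtain ⟨i, rfl⟩ := List.mem_ofFn.mp hx
  exact Ideal.subset_span ⟨hJ (hmemJ i), isHomogeneous_linearForm _⟩

end ReesAlgebra

lemma idealHeight_le_height {R : Type*} [CommRing R] {I p : Ideal R} (hp : p.IsPrime)
    (hI : I ≤ p) : idealHeight I ≤ p.height := by
  change _ ≤ (⟨p, hp⟩ : PrimeSpectrum R).asIdeal.height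
  rw [PrimeSpectrum.height_eq_orderHeight]
  exact iInf₂_le (⟨p, hp⟩ : PrimeSpectrum R) hI

lemma minorsIdeal_le_iff {R α β : Type*} [CommRing R] {t : ℕ} {A : Matrix α β R} {p : Ideal R} :
    minorsIdeal t A ≤ p ↔ ∀ (r : Fin t → α) (c : Fin t → β), Function.Injective r →
      Function.Injective c → (A.submatrix r c).det ∈ p := by
  rw [minorsIdeal, Ideal.span_le]
  constructor
  · exact fun h r c hr hc => h ⟨r, c, hr, hc, rfl⟩
  · rintro h _ ⟨r, c, hr, hc, rfl⟩
    exact h r c hr hc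

/-- An order embedding `Fin m ↪o Fin (m + 1)` is determined by the element it misses. -/
noncomputable def finSuccEquivOrderEmb (m : ℕ) :
    Fin (m + 1) ≃ (Fin m ↪o Fin m) × (Fin m ↪o Fin (m + 1)) :=
  Equiv.ofBijective (fun j => (RelEmbedding.refl _, Fin.succAboveOrderEmb j)) <| by
    constructor
    · intro i j hij
      exact Fin.succAbove_left_injective
        (congrArg (fun e : Fin m ↪o Fin (m + 1) => (e : Fin m → Fin (m + 1)))
          (congrArg Prod.snd hij))
    · rintro ⟨e₁, e₂⟩
      obtain ⟨k, hk⟩ : ∃ k, (Finset.univ.image e₂)ᶜ = {k} := by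
        rw [← Finset.card_eq_one, Finset.card_compl,
          Finset.card_image_of_injective _ e₂.injective]
        simp
      refine ⟨k, Prod.ext (DFunLike.coe_injective ?_) (DFunLike.coe_injective ?_)⟩
      · refine (StrictMono.range_inj strictMono_id e₁.strictMono).mp ?_
        rw [(Finite.injective_iff_surjective.mp e₁.injective).range_eq, Set.range_id]
      refine (StrictMono.range_inj (Fin.strictMono_succAbove k) e₂.strictMono).mp ?_
      rw [Fin.range_succAbove, ← Finset.coe_singleton, ← hk]
      simp

lemma Matrix.sum_neg_one_pow_mul_det_submatrix_succAbove {R : Type*} [CommRing R] {m : ℕ}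
    (A : Matrix (Fin m) (Fin (m + 1)) R) (i : Fin m) :
    ∑ j : Fin (m + 1), (-1) ^ (j : ℕ) * A i j * (A.submatrix id j.succAbove).det = 0 := by
  have h := Matrix.det_succ_row_zero (Matrix.of (Fin.cons (A i) A) : Matrix (Fin (m + 1)) _ R)
  rw [Matrix.det_zero_of_row_eq (Fin.succ_ne_zero i).symm rfl] at h
  rw [h]
  rfl

lemma Matrix.exists_det_submatrix_succAbove_ne_zero {R : Type*} [CommRing R] {m : ℕ}
    (A : Matrix (Fin m) (Fin (m + 1)) R) {r : Fin m → Fin m} {c : Fin m → Fin (m + 1)}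
    (hr : Function.Injective r) (hc : Function.Injective c) (h : (A.submatrix r c).det ≠ 0) :
    ∃ k : Fin (m + 1), (A.submatrix id k.succAbove).det ≠ 0 := by
  obtain ⟨k, hk⟩ : ∃ k, k ∉ Set.range c := by
    by_contra! hsurj
    simpa using Fintype.card_le_of_surjective c hsurj
  have hex : ∀ a, ∃ b, k.succAbove b = c a := fun a =>
    Fin.exists_succAbove_eq fun hck => hk ⟨a, hck⟩
  choose π hπ using hex
  have hπi : Function.Injective π := fun a b hab => hc (by rw [← hπ, ← hπ, hab])
  refine ⟨k, fun h0 => h ?_⟩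
  have hsub : A.submatrix r c = ((A.submatrix id k.succAbove).submatrix id
      (Equiv.ofBijective π (Finite.injective_iff_bijective.mp hπi))).submatrix
      (Equiv.ofBijective r (Finite.injective_iff_bijective.mp hr)) id := by
    ext a b
    simp [hπ]
  rw [hsub, Matrix.det_permute, Matrix.det_permute', h0, mul_zero, mul_zero]

theorem statement_16 (K : Type*) [Field K] (d : ℕ) (hd : 0 < d)
    (m : ℕ) (h1m : 1 ≤ m)
    (A : Matrix (Fin m) (Fin (m + 1)) (MvPolynomial (Fin d) K))
    (hgen : idealHeight (minorsIdeal m A) = (2 : ℕ∞))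
    (hj : ∀ j : ℕ, 1 ≤ j → j ≤ m - 1 →
      ((m - j + 2 : ℕ) : ℕ∞) ≤ idealHeight (minorsIdeal j A)) :
    IsLinearType (fun q : (Fin m ↪o Fin m) × (Fin m ↪o Fin (m + 1)) =>
      (A.submatrix ⇑q.1 ⇑q.2).det) := by
  classical
  let σ := finSuccEquivOrderEmb m
  let _ : Fintype ((Fin m ↪o Fin m) × (Fin m ↪o Fin (m + 1))) := Fintype.ofEquiv _ σ
  let B : Matrix (Fin m) ((Fin m ↪o Fin m) × (Fin m ↪o Fin (m + 1))) (MvPolynomial (Fin d) K) :=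
    Matrix.of fun i q => (-1) ^ (σ.symm q : ℕ) * A i (σ.symm q)
  refine isLinearType_of_exists_minor_notMem (by rw [← Fintype.card_congr σ, Fintype.card_fin])
    (((Field.hasHeightRegularSequences K).mvPolynomial _).mvPolynomial _) B ?_ ?_ ?_
  · intro h0
    have hnot : ¬ minorsIdeal m A ≤ ⊥ := by
      intro hle
      have := idealHeight_le_height Ideal.isPrime_bot hle
      rw [hgen, Ideal.height_bot] at this
      simp at this
    rw [minorsIdeal_le_iff] at hnot
    push Not at hnot
    obtain ⟨r, c, hr, hc, hdet⟩ := hnot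
    obtain ⟨k, hk⟩ := A.exists_det_submatrix_succAbove_ne_zero hr hc (by simpa using hdet)
    exact hk (congrFun h0 (σ k))
  · intro i
    rw [← σ.sum_comp, ← A.sum_neg_one_pow_mul_det_submatrix_succAbove i]
    refine Finset.sum_congr rfl fun j _ => ?_
    simp only [B, Matrix.of_apply, Equiv.symm_apply_apply]
    rfl
  · intro p hp
    let t := Nat.findGreatest (fun j => ¬ minorsIdeal j A ≤ p) m
    have ht : ¬ minorsIdeal t A ≤ p := by
      refine Nat.findGreatest_spec (P := fun j => ¬ minorsIdeal j A ≤ p) (Nat.zero_le m) fun h => ?_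
      have := minorsIdeal_le_iff.mp h Fin.elim0 Fin.elim0 (fun a => a.elim0) fun a => a.elim0
      rw [Matrix.det_isEmpty] at this
      exact hp.ne_top ((Ideal.eq_top_iff_one p).mpr this)
    rw [minorsIdeal_le_iff] at ht
    push Not at ht
    obtain ⟨r, c, hr, hc, hdet⟩ := ht
    refine ⟨t, r, σ ∘ c, hr, σ.injective.comp hc, ?_, ?_⟩
    · have hsub : B.submatrix r (σ ∘ c) =
          Matrix.of fun a b => (-1) ^ (c b : ℕ) * A.submatrix r c a b := by
        ext a b
        simp [B]
      rw [hsub, Matrix.det_mul_row]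
      rwa [Ideal.unit_mul_mem_iff_mem]
      exact IsUnit.prod_univ_iff.mpr fun b => isUnit_one.neg.pow _
    · rcases (Nat.findGreatest_le m : t ≤ m).eq_or_lt with htm | htm
      · exact Or.inl htm
      · right
        have hle : minorsIdeal (t + 1) A ≤ p := by
          by_contra hcon
          have := Nat.le_findGreatest (P := fun j => ¬ minorsIdeal j A ≤ p) htm hcon
          exact absurd this (Nat.not_succ_le_self t)
        have hht := idealHeight_le_height hp hle
        have hbound : ((m - t + 1 : ℕ) : ℕ∞) ≤ p.height := by
          rcases (Nat.succ_le_of_lt htm).eq_or_lt with heq | hlt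
          · rw [Nat.succ_eq_add_one] at heq
            rw [heq, hgen] at hht
            rwa [show m - t + 1 = 2 by omega]
          · have := (hj (t + 1) (by omega) (by omega)).trans hht
            rwa [show m - (t + 1) + 2 = m - t + 1 by omega] at this
        calc (m + 1 : ℕ∞) = ((m - t + 1 : ℕ) : ℕ∞) + t := by
              norm_cast; omega
          _ ≤ p.height + t := by gcongr
end
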